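/- Let L be a separable complex Hilbert space and A the germ at 0 of a Hilbert analytic set in L, defined as the zero set V(h) of a holomorphic map h into a complex Hilbert space F. If A does not contain any principal germ at 0 (i.e. no germ of the form V(f) for a single holomorphic function f), then there exist two holomorphic germs f₁, f₂ at 0 such that A ⊆ V(f₁, f₂), and moreover V(f₁, f₂) itself does not contain a principal germ at 0. -/

import Mathlib

noncomputable section
open Set Metric

/-- The model separable Hilbert space ℓ². -/
abbrev EllTwo : Type := lp (fun _ : ℕ => ℂ) 2

/-- A meromorphic function on an open subset `U` of a complex normed space:
locally a quotient `h/g` of holomorphic functions with `g ≢ 0`. -/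
def MeromorphicOnSet {E : Type*} [NormedAddCommGroup E] [NormedSpace ℂ E]
    (f : E → ℂ) (U : Set E) : Prop :=
  ∀ a ∈ U, ∃ V : Set E, IsOpen V ∧ a ∈ V ∧ V ⊆ U ∧ ∃ h g : E → ℂ,
    DifferentiableOn ℂ h V ∧ DifferentiableOn ℂ g V ∧ (∃ z ∈ V, g z ≠ 0) ∧
    ∀ z ∈ V, g z ≠ 0 → f z = h z / g z

/-- A Hilbert analytic subset of an open set `U`: locally the zero set of a
holomorphic map with values in a separable complex Hilbert space. -/
def IsHilbertAnalyticIn {E : Type*} [NormedAddCommGroup E] [NormedSpace ℂ E]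
    (A U : Set E) : Prop :=
  A ⊆ U ∧ ∀ a ∈ U, ∃ V : Set E, IsOpen V ∧ a ∈ V ∧ V ⊆ U ∧
    ∃ h : E → EllTwo, DifferentiableOn ℂ h V ∧ A ∩ V = {z ∈ V | h z = 0}

/-- The germ of `A` at `a` has codimension at least `p`: there is a
`p`-dimensional linear subspace `T` such that, locally near `a`, the affine
subspace `a + T` meets `A` only at `a`. -/
def GermCodimAtLeast {E : Type*} [NormedAddCommGroup E] [NormedSpace ℂ E]
    (A : Set E) (a : E) (p : ℕ) : Prop :=
  ∃ T : Submodule ℂ E, Module.finrank ℂ T = p ∧ ∃ V : Set E, IsOpen V ∧ a ∈ V ∧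
    ∀ z ∈ A ∩ V, z - a ∈ (T : Set E) → z = a

/-- `A` contains a principal germ at `a`: the germ of the zero set of a single
holomorphic function vanishing at `a` (and not identically zero) is contained
in `A`. -/
def ContainsPrincipalGermAt {E : Type*} [NormedAddCommGroup E] [NormedSpace ℂ E]
    (A : Set E) (a : E) : Prop :=
  ∃ V : Set E, IsOpen V ∧ a ∈ V ∧ ∃ f : E → ℂ,
    DifferentiableOn ℂ f V ∧ f a = 0 ∧ (∃ z ∈ V, f z ≠ 0) ∧
    ∃ W : Set E, IsOpen W ∧ a ∈ W ∧ W ⊆ V ∧ {z ∈ W | f z = 0} ⊆ A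

open Filter Topology

section Holomorphic

variable {E : Type*} [NormedAddCommGroup E] [NormedSpace ℂ E]

/-- The derivative of a holomorphic function is continuous. -/
lemma continuousAt_fderiv_of_eventually_differentiableAt {f : E → ℂ} {a : E}
    (hf : ∀ᶠ x in 𝓝 a, DifferentiableAt ℂ f x) : ContinuousAt (fderiv ℂ f) a := by
  have hc : ∀ᶠ x in 𝓝 a, ‖f x - f a‖ < 1 := by
    have := hf.self_of_nhds.continuousAt
    have h2 := this.eventually (ball_mem_nhds (f a) one_pos)
    simpa [dist_eq_norm] using h2
  obtain ⟨R, hR, hb⟩ := Metric.eventually_nhds_iff_ball.1 (hf.and hc)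
  obtain ⟨r, hr, rfl⟩ : ∃ r, 0 < r ∧ R = 4 * r := ⟨R / 4, by positivity, by ring⟩
  have h1 : ∀ z ∈ ball a (3 * r), ‖fderiv ℂ f z‖ ≤ 2 / r := by
    intro z hz
    have hsub : ball z r ⊆ ball a (4 * r) := by
      apply ball_subset_ball'
      rw [mem_ball] at hz
      linarith
    refine Complex.norm_fderiv_le_div_of_mapsTo_ball
      (fun x hx => (hb x (hsub hx)).1.differentiableWithinAt) ?_ hr
    intro x hx
    have e1 := (hb x (hsub hx)).2
    have e2 := (hb z (hsub (mem_ball_self hr))).2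
    rw [mem_closedBall, dist_eq_norm]
    calc ‖f x - f z‖ = ‖(f x - f a) - (f z - f a)‖ := by ring_nf
      _ ≤ ‖f x - f a‖ + ‖f z - f a‖ := norm_sub_le _ _
      _ ≤ 2 := by linarith
  have h2 : ∀ z ∈ ball a (3 * r), ∀ w ∈ ball a (3 * r), ‖f z - f w‖ ≤ 2 / r * ‖z - w‖ := by
    intro z hz w hw
    refine Convex.norm_image_sub_le_of_norm_fderiv_le (𝕜 := ℂ) (s := ball a (3 * r)) ?_ h1
      (convex_ball _ _) hw hz
    intro x hx
    exact (hb x (ball_subset_ball (by linarith) hx)).1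
  have h3 : ∀ z ∈ ball a r, ‖fderiv ℂ f z - fderiv ℂ f a‖ ≤ 4 / r ^ 2 * ‖z - a‖ := by
    intro z hz
    rcases eq_or_ne z a with rfl | hne
    · simp
    have hpos : 0 < ‖z - a‖ := norm_pos_iff.2 (sub_ne_zero.2 hne)
    have hzn : ‖z - a‖ < r := by rwa [mem_ball, dist_eq_norm] at hz
    have key : ∀ u ∈ ball a r, u + (z - a) ∈ ball a (3 * r) ∧ u ∈ ball a (3 * r) := by
      intro u hu
      rw [mem_ball, dist_eq_norm] at hu ⊢
      constructor
      · calc ‖u + (z - a) - a‖ = ‖(u - a) + (z - a)‖ := by congr 1; abel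
          _ ≤ ‖u - a‖ + ‖z - a‖ := norm_add_le _ _
          _ < 3 * r := by linarith
      · rw [mem_ball, dist_eq_norm]; linarith
    have hda : ∀ u ∈ ball a r, DifferentiableAt ℂ (fun u => f (u + (z - a)) - f u) u := by
      intro u hu
      have d1 := (hb _ (ball_subset_ball (by linarith) (key u hu).1)).1
      have d2 := (hb _ (ball_subset_ball (by linarith) (key u hu).2)).1
      exact (d1.comp u (by fun_prop)).sub d2
    have hval : ∀ u ∈ ball a r, ‖f (u + (z - a)) - f u‖ ≤ 2 / r * ‖z - a‖ := by
      intro u hu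
      simpa using h2 _ (key u hu).1 _ (key u hu).2
    have hmain := Complex.norm_fderiv_le_div_of_mapsTo_ball (f := fun u => f (u + (z - a)) - f u)
      (c := a) (R₁ := r) (R₂ := 4 / r * ‖z - a‖)
      (fun u hu => (hda u hu).differentiableWithinAt) ?_ hr
    · have hza : a + (z - a) = z := by abel
      have d1 : DifferentiableAt ℂ f (a + (z - a)) :=
        (hb _ (ball_subset_ball (by linarith) (key a (mem_ball_self hr)).1)).1
      have d3 : DifferentiableAt ℂ (fun u => f (u + (z - a))) a :=
        d1.comp a (f := fun u => u + (z - a)) (by fun_prop)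
      rw [fderiv_fun_sub d3 hf.self_of_nhds, fderiv_comp_add_right, hza] at hmain
      calc _ ≤ _ := hmain
        _ = _ := by field_simp
    · intro u hu
      rw [mem_closedBall, dist_eq_norm]
      calc _ ≤ _ := norm_sub_le _ _
        _ ≤ 2 / r * ‖z - a‖ + 2 / r * ‖z - a‖ := add_le_add (hval u hu) (hval a (mem_ball_self hr))
        _ = _ := by ring
  rw [Metric.continuousAt_iff]
  intro ε hε
  refine ⟨min r (ε * r ^ 2 / 4), by positivity, fun {x} hx => ?_⟩
  rw [lt_min_iff] at hx
  rw [dist_eq_norm]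
  refine (h3 x hx.1).trans_lt ?_
  rw [← dist_eq_norm]
  calc _ < 4 / r ^ 2 * (ε * r ^ 2 / 4) := by gcongr; exact hx.2
    _ = ε := by field_simp

lemma eventually_forall_of_isCompact {X Y : Type*} [TopologicalSpace X] [TopologicalSpace Y]
    {K : Set X} (hK : IsCompact K) {y : Y} {p : X × Y → Prop}
    (h : ∀ x ∈ K, ∀ᶠ w in 𝓝 (x, y), p w) : ∀ᶠ z in 𝓝 y, ∀ x ∈ K, p (x, z) :=
  hK.eventually_forall_of_forall_eventually fun x hx =>
    (continuous_swap.tendsto (y, x)).eventually (h x hx)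

/-- Circle integrals of a holomorphic function depend holomorphically on parameters. -/
lemma eventually_differentiableAt_circleIntegral {H : Type*} [NormedAddCommGroup H]
    [NormedSpace ℂ H] {k : ℂ × H → ℂ} {ρ : ℝ} (hρ : 0 ≤ ρ)
    (hk : ∀ s ∈ sphere (0 : ℂ) ρ, ∀ᶠ x in 𝓝 (s, (0 : H)), DifferentiableAt ℂ k x) :
    ∀ᶠ z in 𝓝 (0 : H), DifferentiableAt ℂ (fun z => ∮ s in C(0, ρ), k (s, z)) z := by
  have hcp : IsCompact (sphere (0 : ℂ) ρ) := isCompact_sphere _ _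
  have key : ∀ s ∈ sphere (0 : ℂ) ρ, ∀ᶠ x in 𝓝 (s, (0 : H)),
      ContinuousAt (fderiv ℂ k) x ∧ DifferentiableAt ℂ k x ∧
        ‖fderiv ℂ k x‖ ≤ ‖fderiv ℂ k (s, 0)‖ + 1 := by
    intro s hs
    have h1 := (hk s hs).eventually_nhds.mono
      fun x hx => continuousAt_fderiv_of_eventually_differentiableAt hx
    have h2 : ∀ᶠ x in 𝓝 (s, (0 : H)), ‖fderiv ℂ k x‖ < ‖fderiv ℂ k (s, 0)‖ + 1 :=
      h1.self_of_nhds.norm.eventually (gt_mem_nhds (by linarith))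
    filter_upwards [h1, hk s hs, h2] with x a b c using ⟨a, b, c.le⟩
  obtain ⟨M, hM⟩ : ∃ M, ∀ᶠ z in 𝓝 (0 : H), ∀ s ∈ sphere (0 : ℂ) ρ,
      ContinuousAt (fderiv ℂ k) (s, z) ∧ DifferentiableAt ℂ k (s, z) ∧
        ‖fderiv ℂ k (s, z)‖ ≤ M := by
    have hc : ContinuousOn (fun s => ‖fderiv ℂ k (s, (0 : H))‖) (sphere (0 : ℂ) ρ) := by
      intro s hs
      have := (key s hs).self_of_nhds.1
      exact (ContinuousAt.comp (f := fun s : ℂ => (s, (0 : H))) this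
        (by fun_prop)).norm.continuousWithinAt
    obtain ⟨M, hM⟩ := hcp.bddAbove_image hc
    refine ⟨M + 1, ?_⟩
    refine eventually_forall_of_isCompact (p := fun x => ContinuousAt (fderiv ℂ k) x ∧
      DifferentiableAt ℂ k x ∧ ‖fderiv ℂ k x‖ ≤ M + 1) hcp fun s hs => ?_
    filter_upwards [key s hs] with x hx
    exact ⟨hx.1, hx.2.1, hx.2.2.trans (add_le_add_left (hM ⟨s, hs, rfl⟩) 1)⟩
  obtain ⟨t, htm, ht⟩ := hM.exists_mem
  filter_upwards [eventually_mem_nhds_iff.2 htm] with z₀ hz₀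
  have hcm : ∀ θ : ℝ, circleMap 0 ρ θ ∈ sphere (0 : ℂ) ρ := fun θ => circleMap_mem_sphere _ hρ _
  simp only [circleIntegral]
  have hcont : ∀ z ∈ t, Continuous fun θ : ℝ =>
      deriv (circleMap 0 ρ) θ • k (circleMap 0 ρ θ, z) := by
    intro z hz
    refine Continuous.smul ((contDiff_circleMap 0 ρ).continuous_deriv le_rfl) ?_
    rw [continuous_iff_continuousAt]
    intro θ
    exact ContinuousAt.comp (f := fun θ : ℝ => (circleMap 0 ρ θ, z))
      (ht z hz _ (hcm θ)).2.1.continuousAt (by fun_prop)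
  have hcont' : Continuous fun θ : ℝ => deriv (circleMap 0 ρ) θ •
      (fderiv ℂ k (circleMap 0 ρ θ, z₀)).comp (ContinuousLinearMap.inr ℂ ℂ H) := by
    refine Continuous.smul ((contDiff_circleMap 0 ρ).continuous_deriv le_rfl) ?_
    refine Continuous.clm_comp ?_ continuous_const
    rw [continuous_iff_continuousAt]
    intro θ
    exact ContinuousAt.comp (f := fun θ : ℝ => (circleMap 0 ρ θ, z₀))
      (ht z₀ (mem_of_mem_nhds hz₀) _ (hcm θ)).1 (by fun_prop)
  refine (intervalIntegral.hasFDerivAt_integral_of_dominated_of_fderiv_le (𝕜 := ℂ)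
    (F := fun z θ => deriv (circleMap 0 ρ) θ • k (circleMap 0 ρ θ, z))
    (F' := fun z θ => deriv (circleMap 0 ρ) θ •
      (fderiv ℂ k (circleMap 0 ρ θ, z)).comp (ContinuousLinearMap.inr ℂ ℂ H))
    (bound := fun _ => ρ * (M * 1)) hz₀ ?_ ?_ ?_ ?_ ?_ ?_).differentiableAt
  · filter_upwards [hz₀] with z hz using (hcont z hz).aestronglyMeasurable
  · exact (hcont z₀ (mem_of_mem_nhds hz₀)).intervalIntegrable _ _
  · exact hcont'.aestronglyMeasurable
  · refine Eventually.of_forall fun θ _ z hz => ?_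
    rw [norm_smul]
    have e1 : ‖deriv (circleMap 0 ρ) θ‖ = ρ := by simp [abs_of_nonneg hρ]
    have e3 := (ht z hz _ (hcm θ)).2.2
    rw [e1]
    refine mul_le_mul_of_nonneg_left ((ContinuousLinearMap.opNorm_comp_le _ _).trans ?_) hρ
    exact mul_le_mul e3 (ContinuousLinearMap.norm_inr_le_one _ _ _) (norm_nonneg _)
      ((norm_nonneg _).trans e3)
  · exact intervalIntegrable_const
  · refine Eventually.of_forall fun θ _ z hz => ?_
    refine HasFDerivAt.fun_const_smul ?_ _
    exact (ht z hz _ (hcm θ)).2.1.hasFDerivAt.comp z (hasFDerivAt_prodMk_right _ _)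

end Holomorphic

section RootFactorization

lemma pow_card_le_norm_prod_sub {s : Multiset ℂ} {a : ℝ} (ha : 0 ≤ a) {t : ℂ}
    (h : ∀ τ ∈ s, a ≤ ‖t - τ‖) : a ^ s.card ≤ ‖(s.map fun τ => t - τ).prod‖ := by
  induction s using Multiset.induction with
  | empty => simp
  | cons τ s ih =>
    rw [Multiset.map_cons, Multiset.prod_cons, norm_mul, Multiset.card_cons, pow_succ']
    exact mul_le_mul (h τ (Multiset.mem_cons_self _ _))
      (ih fun x hx => h x (Multiset.mem_cons_of_mem hx)) (by positivity) (norm_nonneg _)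

lemma norm_prod_sub_le_pow_card {s : Multiset ℂ} {a : ℝ} {t : ℂ}
    (h : ∀ τ ∈ s, ‖t - τ‖ ≤ a) : ‖(s.map fun τ => t - τ).prod‖ ≤ a ^ s.card := by
  induction s using Multiset.induction with
  | empty => simp
  | cons τ s ih =>
    rw [Multiset.map_cons, Multiset.prod_cons, norm_mul, Multiset.card_cons, pow_succ']
    have h1 := h τ (Multiset.mem_cons_self _ _)
    exact mul_le_mul h1 (ih fun x hx => h x (Multiset.mem_cons_of_mem hx)) (norm_nonneg _)
      ((norm_nonneg _).trans h1)

/-- A holomorphic function on a disc vanishing at `τ` is divisible by `t - τ`. -/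
lemma exists_eq_sub_mul {R : ℝ} {n : ℂ → ℂ} (hn : DifferentiableOn ℂ n (ball 0 R)) {τ : ℂ}
    (hτ : τ ∈ ball (0 : ℂ) R) (h0 : n τ = 0) :
    ∃ w : ℂ → ℂ, DifferentiableOn ℂ w (ball 0 R) ∧ ∀ t, n t = (t - τ) * w t := by
  refine ⟨dslope n τ, (Complex.differentiableOn_dslope (isOpen_ball.mem_nhds hτ)).2 hn,
    fun t => ?_⟩
  have := sub_smul_dslope n τ t
  rw [h0, sub_zero, smul_eq_mul] at this
  exact this.symm

lemma exists_eq_prod_sub_mul_of_norm_le {R C : ℝ} {n u : ℂ → ℂ} {s : Multiset ℂ}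
    (hs : ∀ τ ∈ s, τ ∈ ball (0 : ℂ) R) (hn : DifferentiableOn ℂ n (ball 0 R))
    (hu : DifferentiableOn ℂ u (ball 0 R))
    (h : ∀ t ∈ ball (0 : ℂ) R, ‖n t‖ ≤ C * ‖(s.map fun τ => t - τ).prod * u t‖) :
    ∃ w : ℂ → ℂ, DifferentiableOn ℂ w (ball 0 R) ∧
      ∀ t, n t = (s.map fun τ => t - τ).prod * w t := by
  induction s using Multiset.induction generalizing n with
  | empty => exact ⟨n, hn, by simp⟩
  | cons τ s ih =>
    have hτ := hs τ (Multiset.mem_cons_self _ _)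
    have hn0 : n τ = 0 := by
      have := h τ hτ
      simpa using this
    obtain ⟨n', hn', hnn'⟩ := exists_eq_sub_mul hn hτ hn0
    have hcont : ContinuousOn (fun t => C * ‖(s.map fun τ => t - τ).prod * u t‖ - ‖n' t‖)
        (ball 0 R) := by
      refine ContinuousOn.sub (continuousOn_const.mul (ContinuousOn.norm
        (ContinuousOn.mul ?_ hu.continuousOn))) hn'.continuousOn.norm
      exact (continuous_multiset_prod s fun τ _ => by fun_prop).continuousOn
    obtain ⟨w, hw, hnw⟩ := ih (n := n') (fun x hx => hs x (Multiset.mem_cons_of_mem hx)) hn' (by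
      have hne : ∀ t ∈ ball (0 : ℂ) R, t ≠ τ →
          0 ≤ C * ‖(s.map fun τ => t - τ).prod * u t‖ - ‖n' t‖ := by
        intro t ht hne
        have h1 := h t ht
        rw [hnn', Multiset.map_cons, Multiset.prod_cons, mul_assoc, norm_mul, norm_mul,
          mul_left_comm] at h1
        have := le_of_mul_le_mul_left h1 (norm_pos_iff.2 (sub_ne_zero.2 hne))
        linarith
      intro t ht
      rcases eq_or_ne t τ with rfl | hne'
      · have hc := (hcont.continuousAt (isOpen_ball.mem_nhds hτ)).mono_left
          (nhdsWithin_le_nhds (s := {t}ᶜ))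
        have h2 : ∀ᶠ x in 𝓝[≠] t, 0 ≤ C * ‖(s.map fun τ => x - τ).prod * u x‖ - ‖n' x‖ := by
          filter_upwards [self_mem_nhdsWithin, nhdsWithin_le_nhds (isOpen_ball.mem_nhds hτ)]
            with x hx hx2 using hne x hx2 hx
        have := ge_of_tendsto hc h2
        linarith
      · have := hne t ht hne'
        linarith)
    refine ⟨w, hw, fun t => ?_⟩
    rw [hnn', hnw, Multiset.map_cons, Multiset.prod_cons, mul_assoc]

variable {H : Type*} [NormedAddCommGroup H] [NormedSpace ℂ H]

/-- If `f (·, 0)` vanishes to order `m` at `0`, then for small `z` the function `f (·, z)` has at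
most `m` zeros near `0`, and these can be factored out. -/
lemma exists_eventually_root_factorization {f : ℂ × H → ℂ}
    (hf : ∀ᶠ x in 𝓝 (0 : ℂ × H), DifferentiableAt ℂ f x) {m : ℕ} {u₀ : ℂ → ℂ}
    (hu₀ : ContinuousAt u₀ 0) (hu₀0 : u₀ 0 ≠ 0)
    (hfu : ∀ᶠ t in 𝓝 (0 : ℂ), f (t, 0) = t ^ m * u₀ t) :
    ∃ R > 0, ∀ ρ, 0 < ρ → ρ < R → ∀ᶠ z in 𝓝 (0 : H),
      (∀ t ∈ ball (0 : ℂ) R, DifferentiableAt ℂ f (t, z)) ∧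
      ∃ s : Multiset ℂ, s.card ≤ m ∧ (∀ τ ∈ s, ‖τ‖ < ρ) ∧
      ∃ u : ℂ → ℂ, DifferentiableOn ℂ u (ball 0 R) ∧ (∀ t ∈ closedBall (0 : ℂ) ρ, u t ≠ 0) ∧
      ∀ t ∈ ball (0 : ℂ) R, f (t, z) = (s.map fun τ => t - τ).prod * u t := by
  obtain ⟨B, hB⟩ : ∃ B, ∀ᶠ x in 𝓝 (0 : ℂ × H), ‖f x‖ < B :=
    ⟨‖f 0‖ + 1, hf.self_of_nhds.continuousAt.norm.eventually (gt_mem_nhds (by linarith))⟩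
  have hc : 0 < ‖u₀ 0‖ / 2 := by positivity
  set c := ‖u₀ 0‖ / 2 with hcdef
  have hu : ∀ᶠ t in 𝓝 (0 : ℂ), c < ‖u₀ t‖ :=
    hu₀.norm.eventually (lt_mem_nhds (by rw [hcdef]; linarith))
  obtain ⟨R₁, hR₁, h1⟩ := Metric.eventually_nhds_iff_ball.1 (hf.and hB)
  obtain ⟨R₂, hR₂, h2⟩ := Metric.eventually_nhds_iff_ball.1 (hfu.and hu)
  have h1' : ∀ t ∈ ball (0 : ℂ) R₁, ∀ z ∈ ball (0 : H) R₁,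
      DifferentiableAt ℂ f (t, z) ∧ ‖f (t, z)‖ < B := by
    intro t ht z hz
    refine h1 _ ?_
    rw [← Prod.mk_zero_zero, ← ball_prod_same]
    exact ⟨ht, hz⟩
  have hBpos : 0 < B := (norm_nonneg _).trans_lt
    (h1' 0 (mem_ball_self hR₁) 0 (mem_ball_self hR₁)).2
  refine ⟨min R₁ R₂, by positivity, fun ρ hρ hρR => ?_⟩
  have hb1 : ball (0 : ℂ) (min R₁ R₂) ⊆ ball 0 R₁ := ball_subset_ball (min_le_left _ _)
  have hb2 : ball (0 : ℂ) (min R₁ R₂) ⊆ ball 0 R₂ := ball_subset_ball (min_le_right _ _)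
  set R := min R₁ R₂
  obtain ⟨σ, hσ, hσρ, hσc⟩ : ∃ σ : ℝ, 0 < σ ∧ σ < ρ / 4 ∧
      B * (4 / ρ) ^ (m + 1) * σ < c / 2 := by
    have hK : 0 < B * (4 / ρ) ^ (m + 1) := by positivity
    refine ⟨min (ρ / 8) (c / 4 / (B * (4 / ρ) ^ (m + 1))), by positivity,
      (min_le_left _ _).trans_lt (by linarith), ?_⟩
    calc _ ≤ B * (4 / ρ) ^ (m + 1) * (c / 4 / (B * (4 / ρ) ^ (m + 1))) := by
          gcongr; exact min_le_right _ _
      _ = c / 4 := by field_simp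
      _ < c / 2 := by linarith
  have hσR : (σ : ℂ) ∈ ball (0 : ℂ) R := by
    simp only [mem_ball, dist_zero_right, Complex.norm_real, Real.norm_eq_abs, abs_of_pos hσ]
    linarith
  have hann : ∀ᶠ z in 𝓝 (0 : H), ∀ t ∈ closedBall (0 : ℂ) ρ \ ball 0 σ, f (t, z) ≠ 0 := by
    refine eventually_forall_of_isCompact (p := fun x => f x ≠ 0)
      ((isCompact_closedBall _ _).diff isOpen_ball) fun t ht => ?_
    have htR : t ∈ ball (0 : ℂ) R := closedBall_subset_ball hρR ht.1
    refine (h1' t (hb1 htR) 0 (mem_ball_self hR₁)).1.continuousAt.eventually_ne ?_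
    rw [(h2 t (hb2 htR)).1]
    have ht0 : t ≠ 0 := by
      rintro rfl
      exact ht.2 (mem_ball_self hσ)
    exact mul_ne_zero (pow_ne_zero _ ht0)
      (norm_pos_iff.1 (hc.trans (h2 t (hb2 htR)).2))
  have hpt : ∀ᶠ z in 𝓝 (0 : H), c * σ ^ m / 2 < ‖f (σ, z)‖ := by
    have hcont : ContinuousAt (fun z : H => f (σ, z)) 0 :=
      ContinuousAt.comp (f := fun z : H => ((σ : ℂ), z))
        (h1' σ (hb1 hσR) 0 (mem_ball_self hR₁)).1.continuousAt (by fun_prop)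
    refine hcont.norm.eventually (lt_mem_nhds ?_)
    beta_reduce
    rw [(h2 _ (hb2 hσR)).1, norm_mul, norm_pow, Complex.norm_real, Real.norm_eq_abs,
      abs_of_pos hσ]
    have := (h2 _ (hb2 hσR)).2
    have hp : 0 < σ ^ m := by positivity
    nlinarith
  filter_upwards [hann, hpt, ball_mem_nhds (0 : H) hR₁] with z hzann hzpt hzR
  refine ⟨fun t ht => (h1' t (hb1 ht) z hzR).1, ?_⟩
  have hfz : DifferentiableOn ℂ (fun t => f (t, z)) (ball 0 R) := by
    intro t ht
    exact ((h1' t (hb1 ht) z hzR).1.comp t (f := fun t : ℂ => (t, z))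
      (by fun_prop)).differentiableWithinAt
  let good : Multiset ℂ → Prop := fun s => (∀ τ ∈ s, ‖τ‖ ≤ ρ) ∧
    ∃ u : ℂ → ℂ, DifferentiableOn ℂ u (ball 0 R) ∧
      ∀ t ∈ ball (0 : ℂ) R, f (t, z) = (s.map fun τ => t - τ).prod * u t
  have hsmall : ∀ s, good s → ∀ τ ∈ s, ‖τ‖ < σ := by
    rintro s ⟨hs, u, hu, hfac⟩ τ hτ
    by_contra! hcon
    refine hzann τ ⟨by simpa using hs τ hτ, by simpa using hcon⟩ ?_
    rw [hfac τ (by simpa using (hs τ hτ).trans_lt hρR), Multiset.prod_eq_zero, zero_mul]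
    exact Multiset.mem_map.2 ⟨τ, hτ, sub_self τ⟩
  have hcard : ∀ s, good s → s.card ≤ m := by
    intro s hgood
    have hsσ := hsmall s hgood
    obtain ⟨hs, u, hu, hfac⟩ := hgood
    by_contra! hcon
    have hul : ∀ t ∈ sphere (0 : ℂ) ρ, ‖u t‖ ≤ B / (ρ / 2) ^ s.card := by
      intro t ht
      have htn : ‖t‖ = ρ := by simpa using ht
      have htR : t ∈ ball (0 : ℂ) R := by simpa [htn] using hρR
      have hlow : (ρ / 2) ^ s.card ≤ ‖(s.map fun τ => t - τ).prod‖ := by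
        refine pow_card_le_norm_prod_sub (by positivity) fun τ hτ => ?_
        have := norm_sub_norm_le t τ
        have := hsσ τ hτ
        linarith
      rw [le_div_iff₀ (by positivity)]
      calc ‖u t‖ * (ρ / 2) ^ s.card ≤ ‖u t‖ * ‖(s.map fun τ => t - τ).prod‖ := by gcongr
        _ = ‖f (t, z)‖ := by rw [hfac t htR, norm_mul, mul_comm]
        _ ≤ B := (h1' t (hb1 htR) z hzR).2.le
    have hus : ‖u σ‖ ≤ B / (ρ / 2) ^ s.card := by
      refine Complex.norm_le_of_forall_mem_frontier_norm_le (U := ball (0 : ℂ) ρ) isBounded_ball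
        ?_ ?_ ?_
      · refine DifferentiableOn.diffContOnCl ?_
        exact hu.mono (closure_ball_subset_closedBall.trans (closedBall_subset_ball hρR))
      · rwa [frontier_ball _ hρ.ne']
      · refine subset_closure ?_
        simp only [mem_ball, dist_zero_right, Complex.norm_real, Real.norm_eq_abs, abs_of_pos hσ]
        linarith
    have hprod : ‖(s.map fun τ => (σ : ℂ) - τ).prod‖ ≤ (2 * σ) ^ s.card := by
      refine norm_prod_sub_le_pow_card fun τ hτ => ?_
      have h3 := norm_sub_le (σ : ℂ) τ
      rw [Complex.norm_real, Real.norm_eq_abs, abs_of_pos hσ] at h3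
      have := hsσ τ hτ
      linarith
    have : ‖f (σ, z)‖ ≤ c * σ ^ m / 2 := by
      rw [hfac σ hσR, norm_mul]
      calc _ ≤ (2 * σ) ^ s.card * (B / (ρ / 2) ^ s.card) := by gcongr
        _ = B * (4 * σ / ρ) ^ s.card := by
          rw [mul_div_assoc', mul_comm _ B, mul_div_assoc, ← div_pow]
          congr 2
          field_simp
          norm_num
        _ ≤ B * (4 * σ / ρ) ^ (m + 1) := by
          refine mul_le_mul_of_nonneg_left ?_ hBpos.le
          refine pow_le_pow_of_le_one (by positivity) ?_ hcon
          rw [div_le_one hρ]; linarith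
        _ = B * (4 / ρ) ^ (m + 1) * σ * σ ^ m := by
          rw [show 4 * σ / ρ = 4 / ρ * σ by ring, mul_pow, pow_succ σ]; ring
        _ ≤ c / 2 * σ ^ m := by gcongr
        _ = _ := by ring
    linarith
  have hne : {k | ∃ s, good s ∧ s.card = k}.Nonempty :=
    ⟨0, 0, ⟨by simp, fun t => f (t, z), hfz, by simp⟩, by simp⟩
  have hbdd : BddAbove {k | ∃ s, good s ∧ s.card = k} :=
    ⟨m, by rintro _ ⟨s, hs, rfl⟩; exact hcard s hs⟩
  obtain ⟨s, hs, hsmax⟩ := Nat.sSup_mem hne hbdd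
  refine ⟨s, hcard s hs, fun τ hτ => (hsmall s hs τ hτ).trans (by linarith), ?_⟩
  obtain ⟨hsρ, u, hu, hfac⟩ := hs
  refine ⟨u, hu, fun τ hτ hu0 => ?_, hfac⟩
  obtain ⟨w, hw, huw⟩ := exists_eq_sub_mul hu (closedBall_subset_ball hρR hτ) hu0
  have hgood : good (τ ::ₘ s) := by
    refine ⟨?_, w, hw, fun t ht => ?_⟩
    · intro x hx
      rcases Multiset.mem_cons.1 hx with rfl | hx
      · simpa using hτ
      · exact hsρ x hx
    · rw [hfac t ht, huw, Multiset.map_cons, Multiset.prod_cons]; ring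
  have := le_csSup hbdd ⟨_, hgood, rfl⟩
  rw [Multiset.card_cons, hsmax] at this
  omega

end RootFactorization

open Polynomial

section Identity

variable {H : Type*} [NormedAddCommGroup H] [NormedSpace ℂ H]

lemma analyticOnNhd_comp_line {s : Set H} (hs : IsOpen s) {f : H → ℂ}
    (hf : DifferentiableOn ℂ f s) (a v : H) :
    AnalyticOnNhd ℂ (fun t : ℂ => f (a + t • v)) ((fun t : ℂ => a + t • v) ⁻¹' s) := by
  have hc : Continuous fun t : ℂ => a + t • v := by fun_prop
  refine DifferentiableOn.analyticOnNhd ?_ (hs.preimage hc)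
  exact hf.comp (by fun_prop) fun t ht => ht

lemma isPreconnected_preimage_line {s : Set H} (hs : Convex ℝ s) (a v : H) :
    IsPreconnected ((fun t : ℂ => a + t • v) ⁻¹' s) := by
  refine Convex.isPreconnected fun x hx y hy α β hα hβ hαβ => ?_
  have := hs hx hy hα hβ hαβ
  simp only [mem_preimage] at this ⊢
  convert this using 1
  have e : a = (α + β) • a := by rw [hαβ, one_smul]
  conv_lhs => rw [e]
  simp only [smul_add, add_smul, smul_assoc]
  abel

/-- Germs of holomorphic functions have no zero divisors. -/
lemma eventuallyEq_zero_or_of_mul_eventuallyEq_zero {f g : H → ℂ}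
    (hf : ∀ᶠ z in 𝓝 (0 : H), DifferentiableAt ℂ f z)
    (hg : ∀ᶠ z in 𝓝 (0 : H), DifferentiableAt ℂ g z)
    (h : ∀ᶠ z in 𝓝 (0 : H), f z * g z = 0) :
    (∀ᶠ z in 𝓝 (0 : H), f z = 0) ∨ ∀ᶠ z in 𝓝 (0 : H), g z = 0 := by
  obtain ⟨r, hr, hball⟩ := Metric.eventually_nhds_iff_ball.1 (hf.and (hg.and h))
  have hfd : DifferentiableOn ℂ f (ball 0 r) := fun z hz =>
    (hball z hz).1.differentiableWithinAt
  have hgd : DifferentiableOn ℂ g (ball 0 r) := fun z hz =>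
    (hball z hz).2.1.differentiableWithinAt
  by_contra! hcon
  have hex : ∀ {k : H → ℂ}, (∃ᶠ z in 𝓝 (0 : H), k z ≠ 0) → ∃ z ∈ ball (0 : H) r, k z ≠ 0 := by
    intro k hk
    obtain ⟨z, hz, hz'⟩ := (hk.and_eventually (ball_mem_nhds (0 : H) hr)).exists
    exact ⟨z, hz', hz⟩
  obtain ⟨a, ha, hfa⟩ := hex hcon.1
  obtain ⟨b, hb, hgb⟩ := hex hcon.2
  have h0 : (0 : ℂ) ∈ (fun t : ℂ => a + t • (b - a)) ⁻¹' ball (0 : H) r := by simpa using ha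
  have h1 : (1 : ℂ) ∈ (fun t : ℂ => a + t • (b - a)) ⁻¹' ball (0 : H) r := by simpa using hb
  rcases AnalyticOnNhd.eq_zero_or_eq_zero_of_mul_eq_zero
    (analyticOnNhd_comp_line isOpen_ball hfd a (b - a))
    (analyticOnNhd_comp_line isOpen_ball hgd a (b - a))
    (fun t ht => (hball _ ht).2.2)
    (isPreconnected_preimage_line (convex_ball _ _) a (b - a)) with h | h
  · exact hfa (by simpa using h 0 h0)
  · exact hgb (by simpa using h 1 h1)

lemma not_eventually_eq_zero_smul {r : ℝ} {f : H → ℂ} (hf : DifferentiableOn ℂ f (ball 0 r))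
    {e : H} (he : e ∈ ball (0 : H) r) (hfe : f e ≠ 0) :
    ¬ ∀ᶠ t in 𝓝 (0 : ℂ), f (t • e) = 0 := by
  intro hcon
  have hr : 0 < r := pos_of_mem_ball he
  have := AnalyticOnNhd.eqOn_zero_of_preconnected_of_eventuallyEq_zero
    (analyticOnNhd_comp_line isOpen_ball hf 0 e)
    (isPreconnected_preimage_line (convex_ball _ _) 0 e) (z₀ := 0)
    (by simpa using hr) (by simpa [EventuallyEq] using hcon)
  exact hfe (by simpa using this (x := 1) (by simpa using he))

end Identity

section Divisibility

variable {H : Type*} [NormedAddCommGroup H] [NormedSpace ℂ H]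

lemma prod_sub_ne_zero {ρ : ℝ} {s : Multiset ℂ} (hs : ∀ τ ∈ s, ‖τ‖ < ρ) {t : ℂ} (ht : ‖t‖ = ρ) :
    (s.map fun τ => t - τ).prod ≠ 0 := by
  rw [Ne, Multiset.prod_eq_zero_iff]
  intro h
  obtain ⟨τ, hτ, h⟩ := Multiset.mem_map.1 h
  have := hs τ hτ
  rw [← sub_eq_zero.1 h, ht] at this
  exact lt_irrefl _ this

lemma exists_root_factorization_le {f : ℂ × H → ℂ}
    (hf : ∀ᶠ x in 𝓝 (0 : ℂ × H), DifferentiableAt ℂ f x) {m : ℕ} {u₀ : ℂ → ℂ}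
    (hu₀ : ContinuousAt u₀ 0) (hu₀0 : u₀ 0 ≠ 0)
    (hfu : ∀ᶠ t in 𝓝 (0 : ℂ), f (t, 0) = t ^ m * u₀ t) {R₀ : ℝ} (hR₀ : 0 < R₀) :
    ∃ R > 0, R ≤ R₀ ∧ ∀ ρ, 0 < ρ → ρ < R →
      (∀ t ∈ sphere (0 : ℂ) ρ, ∀ᶠ x in 𝓝 (t, (0 : H)), DifferentiableAt ℂ f x ∧ f x ≠ 0) ∧
      ∀ᶠ z in 𝓝 (0 : H), (∀ t ∈ ball (0 : ℂ) R, DifferentiableAt ℂ f (t, z)) ∧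
        ∃ s : Multiset ℂ, s.card ≤ m ∧ (∀ τ ∈ s, ‖τ‖ < ρ) ∧ ∃ u : ℂ → ℂ,
          DifferentiableOn ℂ u (ball 0 R) ∧ (∀ t ∈ closedBall (0 : ℂ) ρ, u t ≠ 0) ∧
          ∀ t ∈ ball (0 : ℂ) R, f (t, z) = (s.map fun τ => t - τ).prod * u t := by
  obtain ⟨R, hR, hfac⟩ := exists_eventually_root_factorization hf hu₀ hu₀0 hfu
  refine ⟨min R R₀, lt_min hR hR₀, min_le_right _ _, fun ρ hρ hρR => ?_⟩
  have hsub : ball (0 : ℂ) (min R R₀) ⊆ ball 0 R := ball_subset_ball (min_le_left _ _)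
  have hfac := hfac ρ hρ (hρR.trans_le (min_le_left _ _))
  refine ⟨fun t ht => ?_, ?_⟩
  · have htR : t ∈ ball (0 : ℂ) R := by
      rw [mem_sphere_zero_iff_norm] at ht
      rw [mem_ball_zero_iff, ht]
      exact hρR.trans_le (min_le_left _ _)
    have hd : ∀ᶠ x in 𝓝 (t, (0 : H)), DifferentiableAt ℂ f x := by
      rw [nhds_prod_eq]
      filter_upwards [(isOpen_ball.eventually_mem htR).prod_mk hfac] with x hx
      exact hx.2.1 _ hx.1
    refine hd.and (hd.self_of_nhds.continuousAt.eventually_ne ?_)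
    obtain ⟨-, s, -, hs, u, -, hu, hfs⟩ := hfac.self_of_nhds
    rw [hfs t htR]
    exact mul_ne_zero (prod_sub_ne_zero hs (by simpa using ht)) (hu t (sphere_subset_closedBall ht))
  · filter_upwards [hfac] with z ⟨h1, s, hm, hs, u, hu, hu0, hfs⟩
    exact ⟨fun t ht => h1 t (hsub ht), s, hm, hs, u, hu.mono hsub, hu0, fun t ht => hfs t (hsub ht)⟩

/-- Riemann's extension theorem for quotients: a holomorphic function dominated by
another one is divisible by it. -/
lemma exists_eq_mul_of_norm_le {n d : H → ℂ}
    (hn : ∀ᶠ z in 𝓝 (0 : H), DifferentiableAt ℂ n z)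
    (hd : ∀ᶠ z in 𝓝 (0 : H), DifferentiableAt ℂ d z) {C : ℝ}
    (h : ∀ᶠ z in 𝓝 (0 : H), ‖n z‖ ≤ C * ‖d z‖) (hd0 : ¬ ∀ᶠ z in 𝓝 (0 : H), d z = 0) :
    ∃ q : H → ℂ, (∀ᶠ z in 𝓝 (0 : H), DifferentiableAt ℂ q z) ∧
      ∀ᶠ z in 𝓝 (0 : H), n z = d z * q z := by
  obtain ⟨r, hr, hball⟩ := Metric.eventually_nhds_iff_ball.1 (hn.and (hd.and h))
  have hdd : DifferentiableOn ℂ d (ball 0 r) := fun z hz =>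
    (hball z hz).2.1.differentiableWithinAt
  obtain ⟨e, he, hde⟩ : ∃ e ∈ ball (0 : H) r, d e ≠ 0 := by
    obtain ⟨z, hz, hz'⟩ := ((not_eventually.1 hd0).and_eventually (ball_mem_nhds (0 : H) hr)).exists
    exact ⟨z, hz', hz⟩
  have hline : AnalyticAt ℂ (fun t : ℂ => d (0 + t • e)) 0 :=
    analyticOnNhd_comp_line isOpen_ball hdd 0 e 0 (by simpa using hr)
  obtain ⟨m, u₀, hu₀, hu₀0, hfu⟩ := hline.exists_eventuallyEq_pow_smul_nonzero_iff.2
    (by simpa using not_eventually_eq_zero_smul hdd he hde)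
  set σ : ℂ × H → H := fun x => x.2 + x.1 • e with hσ
  have hσd : Differentiable ℂ σ := by fun_prop
  have hσt : Tendsto σ (𝓝 0) (𝓝 0) := by simpa [hσ] using hσd.continuous.tendsto 0
  have hcomp : ∀ {k : H → ℂ} {x}, DifferentiableAt ℂ k (σ x) →
      DifferentiableAt ℂ (fun x => k (σ x)) x := fun hk => hk.comp _ hσd.differentiableAt
  obtain ⟨R, hR, hR1, hfac⟩ := exists_root_factorization_le (f := fun x => d (σ x))
    ((hσt.eventually hd).mono fun x hx => hcomp hx) hu₀.continuousAt hu₀0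
    (by simpa [hσ, smul_eq_mul] using hfu) one_pos
  obtain ⟨hsph, hfac⟩ := hfac (R / 2) (by positivity) (by linarith)
  have hσball : ∀ᶠ z in 𝓝 (0 : H), ∀ t ∈ ball (0 : ℂ) R, σ (t, z) ∈ ball (0 : H) r := by
    have he' : 0 < r - ‖e‖ := by simpa using he
    filter_upwards [ball_mem_nhds (0 : H) he'] with z hz t ht
    rw [mem_ball_zero_iff] at *
    calc ‖z + t • e‖ ≤ ‖z‖ + ‖t‖ * ‖e‖ := by simpa [norm_smul] using norm_add_le z (t • e)
      _ ≤ ‖z‖ + 1 * ‖e‖ := by gcongr; exact (ht.trans_le hR1).le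
      _ < r := by linarith
  have hsphR : ∀ t ∈ sphere (0 : ℂ) (R / 2), t ∈ ball (0 : ℂ) R := fun t ht => by
    rw [mem_sphere_zero_iff_norm] at ht
    rw [mem_ball_zero_iff, ht]
    linarith
  refine ⟨fun z => (2 * Real.pi * Complex.I)⁻¹ *
    ∮ t in C(0, R / 2), t⁻¹ * (n (σ (t, z)) / d (σ (t, z))), ?_, ?_⟩
  · have := eventually_differentiableAt_circleIntegral (H := H) (ρ := R / 2) (by positivity)
      (k := fun x => x.1⁻¹ * (n (σ x) / d (σ x))) fun t ht => by
        have hxR : ∀ᶠ x in 𝓝 (t, (0 : H)), σ x ∈ ball (0 : H) r := by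
          rw [nhds_prod_eq]
          filter_upwards [(isOpen_ball.eventually_mem (hsphR t ht)).prod_mk hσball] with x hx
          exact hx.2 _ hx.1
        have ht0 : t ≠ 0 := by
          rintro rfl
          simp at ht
          linarith
        filter_upwards [hsph t ht, hxR,
          (continuous_fst.tendsto (t, (0 : H))).eventually_ne ht0] with x h1 h2 h3
        simp only [div_eq_mul_inv]
        exact (differentiableAt_fst.inv h3).mul ((hcomp (hball _ h2).1).mul (h1.1.inv h1.2))
    filter_upwards [this] with z hz
    exact hz.const_mul _
  · filter_upwards [hfac, hσball] with z ⟨h1, s, hm, hs, u, hu, hu0, hfs⟩ hz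
    have hnd : DifferentiableOn ℂ (fun t => n (σ (t, z))) (ball 0 R) := fun t ht =>
      ((hball _ (hz t ht)).1.comp t (by fun_prop)).differentiableWithinAt
    obtain ⟨w, hw, hnw⟩ := exists_eq_prod_sub_mul_of_norm_le (C := C) (s := s)
      (fun τ hτ => by rw [mem_ball_zero_iff]; linarith [hs τ hτ]) hnd hu
      (fun t ht => by rw [← hfs t ht]; exact (hball _ (hz t ht)).2.2)
    have hintegral : (∮ t in C(0, R / 2), t⁻¹ * (n (σ (t, z)) / d (σ (t, z)))) =
        ∮ t in C(0, R / 2), (t - 0)⁻¹ • (w t / u t) := by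
      refine circleIntegral.integral_congr (by positivity) fun t ht => ?_
      have h2 := hfs t (hsphR t ht)
      have h3 := hnw t
      have h4 := prod_sub_ne_zero hs (by simpa using ht)
      have h5 := hu0 t (sphere_subset_closedBall ht)
      rw [h2, h3, sub_zero, smul_eq_mul, mul_div_mul_left _ _ h4]
    have hcb : closedBall (0 : ℂ) (R / 2) ⊆ ball 0 R := closedBall_subset_ball (by linarith)
    have hC : DiffContOnCl ℂ (fun t => w t / u t) (ball 0 (R / 2)) := by
      refine DifferentiableOn.diffContOnCl ?_
      rw [closure_ball _ (by positivity)]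
      exact (hw.mono hcb).div (hu.mono hcb) hu0
    have h6 := hC.circleIntegral_sub_inv_smul (w := 0) (by simpa using hR)
    rw [hintegral, h6, smul_eq_mul, inv_mul_cancel_left₀ Complex.two_pi_I_ne_zero]
    have h7 := hfs 0 (by simpa using hR)
    have h8 := hnw 0
    have h9 := hu0 0 (by simp; positivity)
    simp only [hσ, zero_smul, add_zero] at h7 h8
    rw [h7, h8]
    field_simp

end Divisibility

section GermRing

variable (H : Type*) [NormedAddCommGroup H] [NormedSpace ℂ H]

/-- The ring of germs at `0` of holomorphic functions. -/
def holomorphicGerms : Subring (Germ (𝓝 (0 : H)) ℂ) where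
  carrier := {a | ∃ f : H → ℂ, (∀ᶠ z in 𝓝 (0 : H), DifferentiableAt ℂ f z) ∧
    (f : Germ (𝓝 (0 : H)) ℂ) = a}
  mul_mem' := by
    rintro _ _ ⟨f, hf, rfl⟩ ⟨g, hg, rfl⟩
    exact ⟨f * g, by filter_upwards [hf, hg] with z h1 h2 using h1.mul h2, rfl⟩
  one_mem' := ⟨1, Eventually.of_forall fun z => differentiableAt_const 1, rfl⟩
  add_mem' := by
    rintro _ _ ⟨f, hf, rfl⟩ ⟨g, hg, rfl⟩
    exact ⟨f + g, by filter_upwards [hf, hg] with z h1 h2 using h1.add h2, rfl⟩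
  zero_mem' := ⟨0, Eventually.of_forall fun z => differentiableAt_const 0, rfl⟩
  neg_mem' := by
    rintro _ ⟨f, hf, rfl⟩
    exact ⟨-f, by filter_upwards [hf] with z h1 using h1.neg, rfl⟩

variable {H}

namespace holomorphicGerms

/-- The germ of a holomorphic function. -/
def mk (f : H → ℂ) (hf : ∀ᶠ z in 𝓝 (0 : H), DifferentiableAt ℂ f z) : holomorphicGerms H :=
  ⟨f, f, hf, rfl⟩

/-- A holomorphic function representing a germ. -/
def rep (a : holomorphicGerms H) : H → ℂ := Classical.choose a.2

lemma eventually_differentiableAt_rep (a : holomorphicGerms H) :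
    ∀ᶠ z in 𝓝 (0 : H), DifferentiableAt ℂ (rep a) z := (Classical.choose_spec a.2).1

lemma coe_rep (a : holomorphicGerms H) : (rep a : Germ (𝓝 (0 : H)) ℂ) = a :=
  (Classical.choose_spec a.2).2

lemma rep_mk (f : H → ℂ) (hf : ∀ᶠ z in 𝓝 (0 : H), DifferentiableAt ℂ f z) :
    rep (mk f hf) =ᶠ[𝓝 0] f := Germ.coe_eq.1 (coe_rep (mk f hf))

lemma rep_zero : rep (0 : holomorphicGerms H) =ᶠ[𝓝 0] 0 := Germ.coe_eq.1 (coe_rep 0)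

lemma rep_one : rep (1 : holomorphicGerms H) =ᶠ[𝓝 0] 1 := Germ.coe_eq.1 (coe_rep 1)

lemma rep_add (a b : holomorphicGerms H) : rep (a + b) =ᶠ[𝓝 0] rep a + rep b :=
  Germ.coe_eq.1 (by rw [coe_rep, Germ.coe_add, coe_rep, coe_rep]; rfl)

lemma rep_mul (a b : holomorphicGerms H) : rep (a * b) =ᶠ[𝓝 0] rep a * rep b :=
  Germ.coe_eq.1 (by rw [coe_rep, Germ.coe_mul, coe_rep, coe_rep]; rfl)

lemma rep_sum {ι : Type*} (s : Finset ι) (a : ι → holomorphicGerms H) :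
    rep (∑ i ∈ s, a i) =ᶠ[𝓝 0] fun z => ∑ i ∈ s, rep (a i) z := by
  classical
  induction s using Finset.induction_on with
  | empty => simpa using! rep_zero
  | insert i s hi ih =>
    rw [Finset.sum_insert hi]
    filter_upwards [rep_add (a i) (∑ i ∈ s, a i), ih] with z h1 h2
    rw [h1, Pi.add_apply, h2, Finset.sum_insert hi]

lemma eq_of_rep_eventuallyEq {a b : holomorphicGerms H} (h : rep a =ᶠ[𝓝 0] rep b) : a = b :=
  Subtype.ext (by rw [← coe_rep a, ← coe_rep b, Germ.coe_eq.2 h])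

lemma eq_zero_of_rep {a : holomorphicGerms H} (h : ∀ᶠ z in 𝓝 (0 : H), rep a z = 0) : a = 0 :=
  eq_of_rep_eventuallyEq (EventuallyEq.trans h rep_zero.symm)

variable (H) in
/-- Evaluation of germs at `0`. -/
def evalZero : holomorphicGerms H →+* ℂ := Germ.valueRingHom.comp (holomorphicGerms H).subtype

lemma evalZero_apply (a : holomorphicGerms H) : evalZero H a = rep a 0 := by
  change (a : Germ (𝓝 (0 : H)) ℂ).value = _
  rw [← coe_rep a]
  rfl

instance : IsDomain (holomorphicGerms H) := by
  have : NoZeroDivisors (holomorphicGerms H) := ⟨fun {a b} hab => by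
    have h : ∀ᶠ z in 𝓝 (0 : H), rep a z * rep b z = 0 := by
      filter_upwards [rep_mul a b, hab ▸ rep_zero] with z h1 h2
      rw [← Pi.mul_apply, ← h1, h2, Pi.zero_apply]
    exact (eventuallyEq_zero_or_of_mul_eventuallyEq_zero (eventually_differentiableAt_rep a)
      (eventually_differentiableAt_rep b) h).imp eq_zero_of_rep eq_zero_of_rep⟩
  exact NoZeroDivisors.to_isDomain _

lemma isUnit_of_evalZero_ne_zero {a : holomorphicGerms H} (ha : evalZero H a ≠ 0) : IsUnit a := by
  rw [evalZero_apply] at ha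
  have hd := eventually_differentiableAt_rep a
  have hne := hd.self_of_nhds.continuousAt.eventually_ne ha
  have hi : ∀ᶠ z in 𝓝 (0 : H), DifferentiableAt ℂ (fun z => (rep a z)⁻¹) z := by
    filter_upwards [hd, hne] with z h1 h2 using h1.inv h2
  refine IsUnit.of_mul_eq_one (mk _ hi) (eq_of_rep_eventuallyEq ?_)
  filter_upwards [rep_mul a (mk _ hi), rep_mk _ hi, hne, rep_one] with z h1 h2 h3 h4
  rw [h1, Pi.mul_apply, h2, mul_inv_cancel₀ h3, h4, Pi.one_apply]

/-- The ring homomorphism viewing a polynomial with germ coefficients as a germ of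
polynomial-valued functions. -/
def polyGerm : (holomorphicGerms H)[X] →+* Germ (𝓝 (0 : H)) ℂ[X] :=
  eval₂RingHom
    { toFun := fun a => Germ.map (C : ℂ → ℂ[X]) a.1
      map_one' := congrArg (fun f : H → ℂ[X] => (f : Germ (𝓝 (0 : H)) ℂ[X]))
        (funext fun _ => C_1)
      map_zero' := congrArg (fun f : H → ℂ[X] => (f : Germ (𝓝 (0 : H)) ℂ[X]))
        (funext fun _ => C_0)
      map_add' := by
        rintro ⟨_, f, hf, rfl⟩ ⟨_, g, hg, rfl⟩
        exact congrArg (fun f : H → ℂ[X] => (f : Germ (𝓝 (0 : H)) ℂ[X]))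
          (funext fun _ => C_add)
      map_mul' := by
        rintro ⟨_, f, hf, rfl⟩ ⟨_, g, hg, rfl⟩
        exact congrArg (fun f : H → ℂ[X] => (f : Germ (𝓝 (0 : H)) ℂ[X]))
          (funext fun _ => C_mul) }
    ((fun _ => X : H → ℂ[X]) : Germ (𝓝 (0 : H)) ℂ[X])

/-- Specialisation of a polynomial with germ coefficients at a point. -/
def specialize (p : (holomorphicGerms H)[X]) : H → ℂ[X] := Quotient.out (polyGerm p)

lemma coe_specialize (p : (holomorphicGerms H)[X]) :
    (specialize p : Germ (𝓝 (0 : H)) ℂ[X]) = polyGerm p := Quotient.out_eq _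

lemma specialize_add (p q : (holomorphicGerms H)[X]) :
    specialize (p + q) =ᶠ[𝓝 0] specialize p + specialize q :=
  Germ.coe_eq.1 (by rw [Germ.coe_add]; simp only [coe_specialize, map_add])

lemma specialize_sub (p q : (holomorphicGerms H)[X]) :
    specialize (p - q) =ᶠ[𝓝 0] specialize p - specialize q :=
  Germ.coe_eq.1 (by rw [Germ.coe_sub]; simp only [coe_specialize, map_sub])

lemma specialize_mul (p q : (holomorphicGerms H)[X]) :
    specialize (p * q) =ᶠ[𝓝 0] specialize p * specialize q :=
  Germ.coe_eq.1 (by rw [Germ.coe_mul]; simp only [coe_specialize, map_mul])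

lemma specialize_pow (p : (holomorphicGerms H)[X]) (n : ℕ) :
    specialize (p ^ n) =ᶠ[𝓝 0] specialize p ^ n :=
  Germ.coe_eq.1 (by rw [Germ.coe_pow]; simp only [coe_specialize, map_pow])

lemma specialize_C (a : holomorphicGerms H) :
    specialize (C a) =ᶠ[𝓝 0] fun z => C (rep a z) := by
  refine Germ.coe_eq.1 ?_
  rw [coe_specialize, polyGerm, coe_eval₂RingHom, eval₂_C]
  change Germ.map _ (a : Germ (𝓝 (0 : H)) ℂ) = _
  rw [← coe_rep a]
  rfl

lemma specialize_X : specialize (X : (holomorphicGerms H)[X]) =ᶠ[𝓝 0] fun _ => X :=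
  Germ.coe_eq.1 (by rw [coe_specialize, polyGerm, coe_eval₂RingHom, eval₂_X])

lemma specialize_sum {ι : Type*} (s : Finset ι) (p : ι → (holomorphicGerms H)[X]) :
    specialize (∑ i ∈ s, p i) =ᶠ[𝓝 0] fun z => ∑ i ∈ s, specialize (p i) z := by
  refine Germ.coe_eq.1 ?_
  have h : (fun z => ∑ i ∈ s, specialize (p i) z) = ∑ i ∈ s, specialize (p i) := by
    ext1 z; rw [Finset.sum_apply]
  have h2 : ((∑ i ∈ s, specialize (p i) : H → ℂ[X]) : Germ (𝓝 (0 : H)) ℂ[X]) =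
    ∑ i ∈ s, (specialize (p i) : Germ (𝓝 (0 : H)) ℂ[X]) :=
    map_sum (Germ.coeAddHom (𝓝 (0 : H)) : (H → ℂ[X]) →+ Germ (𝓝 (0 : H)) ℂ[X]) _ _
  rw [h, h2, coe_specialize, map_sum]
  simp only [coe_specialize]

lemma specialize_eq_sum (p : (holomorphicGerms H)[X]) :
    specialize p =ᶠ[𝓝 0]
      fun z => ∑ i ∈ Finset.range (p.natDegree + 1), C (rep (p.coeff i) z) * X ^ i := by
  have h := specialize_sum (Finset.range (p.natDegree + 1)) fun i => C (p.coeff i) * X ^ i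
  rw [← p.as_sum_range_C_mul_X_pow] at h
  have h2 : ∀ᶠ z in 𝓝 (0 : H), ∀ i ∈ Finset.range (p.natDegree + 1),
      specialize (C (p.coeff i) * X ^ i) z = C (rep (p.coeff i) z) * X ^ i := by
    rw [Filter.eventually_all_finset]
    intro i _
    filter_upwards [specialize_mul (C (p.coeff i)) (X ^ i), specialize_C (p.coeff i),
      specialize_pow (X : (holomorphicGerms H)[X]) i, specialize_X (H := H)] with z h1 h2 h3 h4
    rw [h1, Pi.mul_apply, h2, h3, Pi.pow_apply, h4]
  filter_upwards [h, h2] with z h1 h2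
  rw [h1]
  exact Finset.sum_congr rfl h2

lemma specialize_zero_eq_map (p : (holomorphicGerms H)[X]) :
    specialize p 0 = p.map (evalZero H) := by
  rw [(specialize_eq_sum p).self_of_nhds]
  conv_rhs => rw [p.as_sum_range_C_mul_X_pow]
  simp only [Polynomial.map_sum, Polynomial.map_mul, map_C, Polynomial.map_pow, map_X,
    evalZero_apply]

lemma eventually_differentiableAt_specialize_eval (p : (holomorphicGerms H)[X]) :
    ∀ᶠ z in 𝓝 (0 : H), ∀ t : ℂ,
      DifferentiableAt ℂ (fun x : ℂ × H => (specialize p x.2).eval x.1) (t, z) := by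
  have h1 : ∀ᶠ z in 𝓝 (0 : H), ∀ i ∈ Finset.range (p.natDegree + 1),
      DifferentiableAt ℂ (rep (p.coeff i)) z := by
    rw [Filter.eventually_all_finset]
    exact fun i _ => eventually_differentiableAt_rep _
  filter_upwards [h1, (specialize_eq_sum p).eventually_nhds] with z h1 h2 t
  have h3 : (fun x : ℂ × H => (specialize p x.2).eval x.1) =ᶠ[𝓝 (t, z)] fun x =>
      ∑ i ∈ Finset.range (p.natDegree + 1), rep (p.coeff i) x.2 * x.1 ^ i := by
    filter_upwards [(continuous_snd.tendsto (t, z)).eventually h2] with x hx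
    rw [hx]
    simp [eval_finsetSum]
  refine DifferentiableAt.congr_of_eventuallyEq ?_ h3
  refine DifferentiableAt.fun_sum fun i hi => ?_
  exact ((h1 i hi).comp (t, z) differentiableAt_snd).mul (differentiableAt_fst.pow i)

lemma specialize_eval_rep (p : (holomorphicGerms H)[X]) (a : holomorphicGerms H) :
    ∀ᶠ z in 𝓝 (0 : H), (specialize p z).eval (rep a z) = rep (p.eval a) z := by
  obtain ⟨q, hq⟩ := X_sub_C_dvd_sub_C_eval (p := p) (a := a)
  rw [sub_eq_iff_eq_add] at hq
  have h := specialize_add ((X - C a) * q) (C (p.eval a))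
  rw [← hq] at h
  filter_upwards [h, specialize_mul (X - C a) q, specialize_sub X (C a), specialize_X (H := H),
    specialize_C a, specialize_C (p.eval a)] with z h1 h2 h3 h4 h5 h6
  rw [h1, Pi.add_apply, h2, Pi.mul_apply, h3, Pi.sub_apply, h4, h5, h6]
  simp

lemma norm_le_of_pow_add_sum_eq_zero {k : ℕ} {c : ℕ → ℂ} {n d : ℂ} {M : ℝ} (hM0 : 0 ≤ M)
    (hM : ∀ i < k, ‖c i‖ ≤ M)
    (h : n ^ k + ∑ i ∈ Finset.range k, c i * d ^ (k - i) * n ^ i = 0) :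
    ‖n‖ ≤ (1 + k * M) * ‖d‖ := by
  have hkM : 0 ≤ k * M := by positivity
  rcases le_or_gt ‖n‖ ‖d‖ with hnd | hnd
  · nlinarith [norm_nonneg d]
  have hn : 0 < ‖n‖ := (norm_nonneg d).trans_lt hnd
  rcases k with _ | k
  · simp at h
  have h1 : ‖n‖ ^ (k + 1) ≤ ∑ i ∈ Finset.range (k + 1), M * (‖d‖ * ‖n‖ ^ k) := by
    rw [← norm_pow, eq_neg_of_add_eq_zero_left h, norm_neg]
    refine norm_sum_le_of_le _ fun i hi => ?_
    have hik := Finset.mem_range.1 hi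
    rw [norm_mul, norm_mul, norm_pow, norm_pow, mul_assoc]
    refine mul_le_mul (hM i hik) ?_ (by positivity) hM0
    obtain ⟨j, rfl⟩ : ∃ j, k = i + j := ⟨k - i, by omega⟩
    rw [show i + j + 1 - i = j + 1 by omega, pow_succ', mul_assoc, pow_add ‖n‖ i j,
      mul_comm (‖d‖ ^ j)]
    gcongr
  rw [Finset.sum_const, Finset.card_range, nsmul_eq_mul, pow_succ'] at h1
  have h2 : ‖n‖ ≤ (k + 1 : ℕ) * M * ‖d‖ :=
    le_of_mul_le_mul_right (by linarith) (pow_pos hn k)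
  nlinarith [norm_nonneg d]

instance : IsIntegrallyClosed (holomorphicGerms H) := by
  refine (isIntegrallyClosed_iff (FractionRing (holomorphicGerms H))).2 fun {x} hx => ?_
  obtain ⟨p, hp, hpx⟩ := hx
  obtain ⟨n, d, hd, rfl⟩ := IsFractionRing.div_surjective (A := holomorphicGerms H) x
  have hd0 : d ≠ 0 := nonZeroDivisors.ne_zero hd
  have h1 := scaleRoots_aeval_eq_zero_of_aeval_div_eq_zero
    (IsFractionRing.injective (holomorphicGerms H) (FractionRing (holomorphicGerms H))) hpx hd
  rw [aeval_algebraMap_apply, FaithfulSMul.algebraMap_eq_zero_iff, coe_aeval_eq_eval] at h1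
  set k := p.natDegree with hk
  obtain ⟨M, hM0, hM⟩ : ∃ M : ℝ, 0 ≤ M ∧ ∀ᶠ z in 𝓝 (0 : H), ∀ i < k, ‖rep (p.coeff i) z‖ ≤ M := by
    refine ⟨∑ i ∈ Finset.range k, (‖rep (p.coeff i) 0‖ + 1), by positivity, ?_⟩
    have : ∀ᶠ z in 𝓝 (0 : H), ∀ i ∈ Finset.range k,
        ‖rep (p.coeff i) z‖ < ‖rep (p.coeff i) 0‖ + 1 := by
      rw [Filter.eventually_all_finset]
      intro i _
      exact (eventually_differentiableAt_rep _).self_of_nhds.continuousAt.norm.eventually_lt_const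
        (lt_add_one _)
    filter_upwards [this] with z hz i hi
    have hi := Finset.mem_range.2 hi
    exact (hz i hi).le.trans (Finset.single_le_sum
      (f := fun i => ‖rep (p.coeff i) 0‖ + 1) (fun _ _ => by positivity) hi)
  have hc : ∀ᶠ z in 𝓝 (0 : H), ∀ i ∈ Finset.range k,
      rep ((p.scaleRoots d).coeff i) z = rep (p.coeff i) z * rep d z ^ (k - i) := by
    rw [Filter.eventually_all_finset]
    intro i _
    rw [coeff_scaleRoots]
    filter_upwards [rep_mul (p.coeff i) (d ^ (k - i)), specialize_C d, specialize_C (d ^ (k - i)),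
      specialize_pow (C d) (k - i)] with z h1 h2 h3 h4
    rw [h1, Pi.mul_apply]
    rw [C_pow, h4, Pi.pow_apply, h2, ← C_pow, C_inj] at h3
    rw [h3]
  have hle : ∀ᶠ z in 𝓝 (0 : H), ‖rep n z‖ ≤ (1 + k * M) * ‖rep d z‖ := by
    have hm : (p.scaleRoots d).coeff k = 1 := by
      rw [hk, coeff_scaleRoots_natDegree]
      exact hp
    filter_upwards [specialize_eval_rep (p.scaleRoots d) n, h1 ▸ rep_zero (H := H), hM, hc,
      specialize_eq_sum (p.scaleRoots d), rep_one (H := H)] with z h2 h3 h4 h5 h6 h7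
    refine norm_le_of_pow_add_sum_eq_zero hM0 (c := fun i => rep (p.coeff i) z) h4 ?_
    rw [h3, h6, natDegree_scaleRoots, ← hk, Finset.sum_range_succ, hm, h7, add_comm] at h2
    simp only [Pi.one_apply, C_1, one_mul, eval_add, eval_pow, eval_X, eval_finsetSum, eval_mul,
      eval_C, Pi.zero_apply] at h2
    rw [← h2]
    congr 1
    exact Finset.sum_congr rfl fun i hi => by rw [h5 i hi]
  obtain ⟨q, hq, hnq⟩ := exists_eq_mul_of_norm_le (eventually_differentiableAt_rep n)
    (eventually_differentiableAt_rep d) hle fun h => hd0 (eq_zero_of_rep h)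
  refine ⟨mk q hq, ?_⟩
  have hn : n = d * mk q hq := eq_of_rep_eventuallyEq (by
    filter_upwards [rep_mul d (mk q hq), rep_mk q hq, hnq] with z h1 h2 h3
    rw [h1, Pi.mul_apply, h2, h3])
  have hd1 : algebraMap _ (FractionRing (holomorphicGerms H)) d ≠ 0 :=
    (FaithfulSMul.algebraMap_eq_zero_iff _ _).not.2 hd0
  rw [eq_div_iff hd1, mul_comm, ← map_mul, ← hn]

end holomorphicGerms

end GermRing

section Weierstrass

variable {H : Type*} [NormedAddCommGroup H] [NormedSpace ℂ H]

open holomorphicGerms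

/-- Integration of polynomials against a function on a circle is linear. -/
lemma exists_linearMap_eq_circleIntegral {ρ : ℝ} (hρ : 0 ≤ ρ) {g : ℂ → ℂ}
    (hg : ContinuousOn g (sphere 0 ρ)) :
    ∃ Λ : ℂ[X] →ₗ[ℂ] ℂ, ∀ q : ℂ[X],
      Λ q = (2 * Real.pi * Complex.I)⁻¹ * ∮ s in C(0, ρ), q.eval s * g s := by
  have hintegral : ∀ q : ℂ[X], CircleIntegrable (fun s => q.eval s * g s) 0 ρ := fun q =>
    (q.continuous.continuousOn.mul hg).circleIntegrable hρ
  refine ⟨{ toFun := fun q => (2 * Real.pi * Complex.I)⁻¹ * ∮ s in C(0, ρ), q.eval s * g s,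
            map_add' := fun p q => ?_, map_smul' := fun a q => ?_ }, fun q => rfl⟩
  · simp only [eval_add, add_mul]
    rw [circleIntegral.integral_add (hintegral p) (hintegral q), mul_add]
  · simp only [eval_smul, smul_eq_mul, mul_assoc, RingHom.id_apply]
    rw [circleIntegral.integral_const_mul]
    ring

lemma inv_two_pi_I_mul_circleIntegral_pow_mul_inv_pow {ρ : ℝ} (hρ : 0 < ρ) (k m : ℕ) :
    (2 * Real.pi * Complex.I)⁻¹ * (∮ s in C(0, ρ), s ^ k * (s ^ m)⁻¹) =
      if k + 1 = m then 1 else 0 := by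
  have h : (∮ s in C(0, ρ), s ^ k * (s ^ m)⁻¹) =
      ∮ s in C(0, ρ), (s - 0) ^ ((k : ℤ) - m) := by
    refine circleIntegral.integral_congr hρ.le fun s hs => ?_
    have hs0 : s ≠ 0 := by
      rintro rfl
      simp at hs
      linarith
    simp only [sub_zero]
    rw [zpow_sub₀ hs0, zpow_natCast, zpow_natCast, div_eq_mul_inv]
  rw [h]
  split_ifs with hkm
  · rw [show (k : ℤ) - m = -1 by omega]
    simp only [zpow_neg_one]
    rw [circleIntegral.integral_sub_center_inv 0 hρ.ne', inv_mul_cancel₀ Complex.two_pi_I_ne_zero]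
  · rw [circleIntegral.integral_sub_zpow_of_ne (by omega), mul_zero]

/-- Solvability of a Hankel system over a local ring. -/
lemma exists_hankel_solution {S : Type*} [CommRing S] (ε : S →+* ℂ)
    (hε : ∀ a, ε a ≠ 0 → IsUnit a) (m : ℕ) (c : ℕ → S)
    (hc : ∀ k, ε (c k) = if k + 1 = m then 1 else 0) :
    ∃ a : Fin m → S, (∀ j, ε (a j) = 0) ∧
      ∀ i : Fin m, ∑ j : Fin m, c (i + j) * a j + c (i + m) = 0 := by
  set M : Matrix (Fin m) (Fin m) S := Matrix.of fun i j => c (i.rev + j) with hM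
  set b : Fin m → S := fun i => c (i.rev + m) with hb
  have hM0 : ε.mapMatrix M = 1 := by
    ext i j
    rw [RingHom.mapMatrix_apply, Matrix.map_apply, hM, Matrix.of_apply, hc, Matrix.one_apply]
    have : ((i.rev : ℕ) + j + 1 = m) ↔ i = j := by
      rw [Fin.val_rev, Fin.ext_iff]
      omega
    simp only [this]
  have hdet : IsUnit M.det := by
    refine hε _ ?_
    rw [RingHom.map_det, hM0, Matrix.det_one]
    exact one_ne_zero
  have hMa : M.mulVec (M⁻¹.mulVec (-b)) = -b := by
    rw [Matrix.mulVec_mulVec, Matrix.mul_nonsing_inv _ hdet, Matrix.one_mulVec]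
  refine ⟨M⁻¹.mulVec (-b), fun j => ?_, fun i => ?_⟩
  · have h2 := RingHom.map_mulVec ε M (M⁻¹.mulVec (-b)) j
    rw [hMa, ← RingHom.mapMatrix_apply, hM0, Matrix.one_mulVec, Pi.neg_apply, map_neg, hb, hc,
      if_neg (by omega), neg_zero] at h2
    exact h2.symm
  · have := congrFun hMa i.rev
    rw [Matrix.mulVec, dotProduct, Pi.neg_apply, hb] at this
    simp only [hM, Matrix.of_apply, Fin.rev_rev] at this
    rw [this, neg_add_cancel]

lemma eval_eq_zero_of_circleIntegral_eq_zero {ρ R : ℝ} (hρ : 0 < ρ) (hρR : ρ < R) {f u : ℂ → ℂ}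
    (hf : ∀ t ∈ ball (0 : ℂ) R, ContinuousAt f t) {m : ℕ} {s : Multiset ℂ} (hsm : s.card ≤ m)
    (hs : ∀ τ ∈ s, ‖τ‖ < ρ) (hu : DifferentiableOn ℂ u (ball 0 R))
    (hu0 : ∀ t ∈ closedBall (0 : ℂ) ρ, u t ≠ 0)
    (hfs : ∀ t ∈ ball (0 : ℂ) R, f t = (s.map fun τ => t - τ).prod * u t) {a : Fin m → ℂ}
    (ha : ∀ i : Fin m, ∑ j : Fin m, (2 * Real.pi * Complex.I)⁻¹ *
        (∮ t in C(0, ρ), t ^ ((i : ℕ) + j) * (f t)⁻¹) * a j + (2 * Real.pi * Complex.I)⁻¹ *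
        (∮ t in C(0, ρ), t ^ ((i : ℕ) + m) * (f t)⁻¹) = 0)
    {τ : ℂ} (hτ : τ ∈ ball (0 : ℂ) ρ) (h0 : f τ = 0) :
    (X ^ m + ∑ j : Fin m, C (a j) * X ^ (j : ℕ)).eval τ = 0 := by
  set p : ℂ[X] := X ^ m + ∑ j : Fin m, C (a j) * X ^ (j : ℕ) with hp
  have hsphR : sphere (0 : ℂ) ρ ⊆ ball 0 R := fun t ht => by
    rw [mem_sphere_zero_iff_norm] at ht
    rwa [mem_ball_zero_iff, ht]
  have hne : ∀ t ∈ sphere (0 : ℂ) ρ, f t ≠ 0 := fun t ht => by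
    rw [hfs t (hsphR ht)]
    exact mul_ne_zero (prod_sub_ne_zero hs (by simpa using ht))
      (hu0 t (sphere_subset_closedBall ht))
  have hcont : ContinuousOn (fun t => (f t)⁻¹) (sphere (0 : ℂ) ρ) :=
    ContinuousOn.inv₀ (fun t ht => (hf t (hsphR ht)).continuousWithinAt) hne
  obtain ⟨Λ, hΛ⟩ := exists_linearMap_eq_circleIntegral hρ.le hcont
  have hXp : ∀ i : Fin m, Λ (X ^ (i : ℕ) * p) = 0 := fun i => by
    have e : X ^ (i : ℕ) * p =
        X ^ ((i : ℕ) + m) + ∑ j : Fin m, a j • X ^ ((i : ℕ) + (j : ℕ)) := by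
      rw [hp, mul_add, pow_add, Finset.mul_sum]
      congr 1
      refine Finset.sum_congr rfl fun j _ => ?_
      rw [smul_eq_C_mul, pow_add]
      ring
    rw [e, map_add, map_sum, add_comm, ← ha i]
    congr 1
    · refine Finset.sum_congr rfl fun j _ => ?_
      rw [map_smul, hΛ, smul_eq_mul, mul_comm]
      simp only [eval_pow, eval_X]
    · rw [hΛ]
      simp only [eval_pow, eval_X]
  have hQp : ∀ Q : ℂ[X], Q.natDegree < m → Λ (Q * p) = 0 := fun Q hQ => by
    rw [Q.as_sum_range_C_mul_X_pow, Finset.sum_mul, map_sum]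
    refine Finset.sum_eq_zero fun i hi => ?_
    rw [mul_assoc, ← smul_eq_C_mul, map_smul,
      hXp ⟨i, by rw [Finset.mem_range] at hi; omega⟩, smul_zero]
  have hτR : τ ∈ ball (0 : ℂ) R := ball_subset_ball hρR.le hτ
  have hτs : τ ∈ s := by
    rw [hfs τ hτR] at h0
    have h5 := (mul_eq_zero.1 h0).resolve_right (hu0 τ (ball_subset_closedBall hτ))
    obtain ⟨σ, hσ, h6⟩ := Multiset.mem_map.1 (Multiset.prod_eq_zero_iff.1 h5)
    rwa [sub_eq_zero.1 h6]
  obtain ⟨s', rfl⟩ := Multiset.exists_cons_of_mem hτs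
  rw [Multiset.card_cons] at hsm
  have h5 := hQp (s'.map fun σ => X - C σ).prod (by
    rw [natDegree_multiset_prod_X_sub_C_eq_card]; omega)
  have h6 : (∮ t in C(0, ρ), ((s'.map fun σ => X - C σ).prod * p).eval t * (f t)⁻¹) =
      ∮ t in C(0, ρ), (t - τ)⁻¹ • (p.eval t / u t) := by
    refine circleIntegral.integral_congr hρ.le fun t ht => ?_
    have h7 := prod_sub_ne_zero hs (t := t) (by simpa using ht)
    rw [hfs t (hsphR ht), Multiset.map_cons, Multiset.prod_cons, eval_mul, eval_multiset_prod,
      Multiset.map_map, smul_eq_mul]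
    rw [Multiset.map_cons, Multiset.prod_cons] at h7
    simp only [Function.comp_apply, eval_sub, eval_X, eval_C]
    have h8 := left_ne_zero_of_mul h7
    have h9 := right_ne_zero_of_mul h7
    have h10 := hu0 t (sphere_subset_closedBall ht)
    field_simp
  have hcb : closedBall (0 : ℂ) ρ ⊆ ball 0 R := closedBall_subset_ball hρR
  have hC : DiffContOnCl ℂ (fun t => p.eval t / u t) (ball 0 ρ) := by
    refine DifferentiableOn.diffContOnCl ?_
    rw [closure_ball _ hρ.ne']
    exact p.differentiable.differentiableOn.div (hu.mono hcb) hu0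
  rw [hΛ, h6, hC.circleIntegral_sub_inv_smul hτ, smul_eq_mul,
    inv_mul_cancel_left₀ Complex.two_pi_I_ne_zero] at h5
  exact (div_eq_zero_iff.1 h5).resolve_right (hu0 τ (ball_subset_closedBall hτ))

lemma holomorphicGerms.specialize_X_pow_add_sum {m : ℕ} (a : Fin m → holomorphicGerms H) :
    ∀ᶠ z in 𝓝 (0 : H), specialize (X ^ m + ∑ j : Fin m, C (a j) * X ^ (j : ℕ)) z =
      X ^ m + ∑ j : Fin m, C (rep (a j) z) * X ^ (j : ℕ) := by
  have h2 : ∀ᶠ z in 𝓝 (0 : H), ∀ j ∈ Finset.univ,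
      specialize (C (a j) * X ^ (j : ℕ)) z = C (rep (a j) z) * X ^ (j : ℕ) := by
    rw [Filter.eventually_all_finset]
    intro j _
    filter_upwards [specialize_mul (C (a j)) (X ^ (j : ℕ)), specialize_C (a j),
      specialize_pow (X : (holomorphicGerms H)[X]) j, specialize_X (H := H)] with z h1 h2 h3 h4
    rw [h1, Pi.mul_apply, h2, h3, Pi.pow_apply, h4]
  filter_upwards [specialize_add (X ^ m) (∑ j : Fin m, C (a j) * X ^ (j : ℕ)),
    specialize_pow (X : (holomorphicGerms H)[X]) m, specialize_X (H := H),
    specialize_sum Finset.univ fun j : Fin m => C (a j) * X ^ (j : ℕ), h2] with z h3 h4 h5 h6 h7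
  rw [h3, Pi.add_apply, h4, Pi.pow_apply, h5, h6, Finset.sum_congr rfl h7]

lemma holomorphicGerms.rep_sum_mul_add {m : ℕ} (a b : Fin m → holomorphicGerms H)
    (c : holomorphicGerms H) :
    ∀ᶠ z in 𝓝 (0 : H), rep (∑ j : Fin m, b j * a j + c) z =
      (∑ j : Fin m, rep (b j) z * rep (a j) z) + rep c z := by
  have h2 : ∀ᶠ z in 𝓝 (0 : H), ∀ j ∈ Finset.univ,
      rep (b j * a j) z = rep (b j) z * rep (a j) z := by
    rw [Filter.eventually_all_finset]
    exact fun j _ => rep_mul _ _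
  filter_upwards [rep_add (∑ j : Fin m, b j * a j) c,
    rep_sum Finset.univ fun j : Fin m => b j * a j, h2] with z h3 h5 h6
  rw [h3, Pi.add_apply, h5, Finset.sum_congr rfl h6]

lemma exists_monic_of_eq_pow {f : ℂ × H → ℂ}
    (hf : ∀ᶠ x in 𝓝 (0 : ℂ × H), DifferentiableAt ℂ f x) {m : ℕ}
    (hfm : ∀ᶠ t in 𝓝 (0 : ℂ), f (t, 0) = t ^ m) :
    ∃ P : (holomorphicGerms H)[X], P.Monic ∧ P.map (evalZero H) = X ^ m ∧
      ∀ᶠ x in 𝓝 (0 : ℂ × H), f x = 0 → (specialize P x.2).eval x.1 = 0 := by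
  obtain ⟨R₀, hR₀, hfm'⟩ := eventually_nhds_iff_ball.1 hfm
  obtain ⟨R, hR, hRR, hfac⟩ := exists_root_factorization_le (u₀ := fun _ => 1) hf
    continuousAt_const one_ne_zero (by simpa using hfm) hR₀
  have hρ : 0 < R / 2 := by positivity
  have hρR : R / 2 < R := by linarith
  obtain ⟨hsph, hfac⟩ := hfac (R / 2) hρ hρR
  generalize R / 2 = ρ at *
  have hI : ∀ k : ℕ, ∀ᶠ z in 𝓝 (0 : H), DifferentiableAt ℂ
      (fun z => (2 * Real.pi * Complex.I)⁻¹ * ∮ s in C(0, ρ), s ^ k * (f (s, z))⁻¹) z := by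
    intro k
    have := eventually_differentiableAt_circleIntegral hρ.le
      (k := fun x : ℂ × H => x.1 ^ k * (f x)⁻¹) fun t ht => by
        filter_upwards [hsph t ht] with x hx
        exact (differentiableAt_fst.pow k).mul (hx.1.inv hx.2)
    filter_upwards [this] with z hz using hz.const_mul _
  obtain ⟨c, hc⟩ : ∃ c : ℕ → holomorphicGerms H, ∀ k, rep (c k) =ᶠ[𝓝 0]
      fun z => (2 * Real.pi * Complex.I)⁻¹ * ∮ s in C(0, ρ), s ^ k * (f (s, z))⁻¹ :=
    ⟨fun k => mk _ (hI k), fun k => rep_mk _ (hI k)⟩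
  obtain ⟨a, ha0, ha⟩ := exists_hankel_solution (evalZero H)
    (fun _ => isUnit_of_evalZero_ne_zero) m c (by
      intro k
      have e : (∮ s in C(0, ρ), s ^ k * (f (s, 0))⁻¹) = ∮ s in C(0, ρ), s ^ k * (s ^ m)⁻¹ := by
        refine circleIntegral.integral_congr hρ.le fun s hs => ?_
        rw [mem_sphere_zero_iff_norm] at hs
        rw [hfm' s (by rw [mem_ball_zero_iff, hs]; linarith)]
      rw [evalZero_apply, (hc k).self_of_nhds]
      beta_reduce
      rw [e, inv_two_pi_I_mul_circleIntegral_pow_mul_inv_pow hρ k m])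
  have hdeg : (∑ j : Fin m, C (a j) * X ^ (j : ℕ)).degree < (m : WithBot ℕ) :=
    (degree_sum_le _ _).trans_lt ((Finset.sup_lt_iff (WithBot.bot_lt_coe m)).2 fun j _ =>
      (degree_C_mul_X_pow_le _ _).trans_lt (Nat.cast_lt.2 j.2))
  refine ⟨X ^ m + ∑ j : Fin m, C (a j) * X ^ (j : ℕ), monic_X_pow_add hdeg, ?_, ?_⟩
  · simp [Polynomial.map_sum, ha0]
  have hrel : ∀ᶠ z in 𝓝 (0 : H), ∀ i : Fin m,
      (∑ j : Fin m, rep (c (i + j)) z * rep (a j) z) + rep (c (i + m)) z = 0 := by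
    rw [Filter.eventually_all]
    intro i
    filter_upwards [rep_sum_mul_add a (fun j => c (i + j)) (c (i + m)),
      ha i ▸ rep_zero (H := H)] with z h1 h2
    rw [← h1, h2, Pi.zero_apply]
  have hcrep : ∀ᶠ z in 𝓝 (0 : H), ∀ k ∈ Finset.range (2 * m), rep (c k) z =
      (2 * Real.pi * Complex.I)⁻¹ * ∮ s in C(0, ρ), s ^ k * (f (s, z))⁻¹ := by
    rw [Filter.eventually_all_finset]
    exact fun k _ => hc k
  have hz : ∀ᶠ z in 𝓝 (0 : H), ∀ τ ∈ ball (0 : ℂ) ρ, f (τ, z) = 0 →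
      (specialize (X ^ m + ∑ j : Fin m, C (a j) * X ^ (j : ℕ)) z).eval τ = 0 := by
    filter_upwards [hfac, hrel, specialize_X_pow_add_sum a, hcrep] with z
      ⟨hfd, s, hsm, hs, u, hu, hu0, hfs⟩ h2 h3 h4 τ hτ h0
    rw [h3]
    refine eval_eq_zero_of_circleIntegral_eq_zero hρ hρR (f := fun t => f (t, z))
      (fun t ht => (hfd t ht).continuousAt.comp (f := fun t => (t, z)) (by fun_prop))
      hsm hs hu hu0 hfs (fun i => ?_) hτ h0
    refine Eq.trans ?_ (h2 i)
    rw [h4 (i + m) (by rw [Finset.mem_range]; omega)]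
    congr 1
    exact Finset.sum_congr rfl fun j _ => by rw [h4 (i + j) (by rw [Finset.mem_range]; omega)]
  have h1 : ∀ᶠ x in 𝓝 ((0 : ℂ), (0 : H)), x.1 ∈ ball (0 : ℂ) ρ ∧ ∀ τ ∈ ball (0 : ℂ) ρ,
      f (τ, x.2) = 0 →
      (specialize (X ^ m + ∑ j : Fin m, C (a j) * X ^ (j : ℕ)) x.2).eval τ = 0 := by
    rw [nhds_prod_eq]
    exact (isOpen_ball.eventually_mem (mem_ball_self hρ)).prod_mk hz
  filter_upwards [h1] with x hx h0
  exact hx.2 x.1 hx.1 h0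

/-- A form of the Weierstrass preparation theorem. -/
lemma exists_monic_of_eq_pow_mul {f : ℂ × H → ℂ}
    (hf : ∀ᶠ x in 𝓝 (0 : ℂ × H), DifferentiableAt ℂ f x) {m : ℕ} {u₀ : ℂ → ℂ}
    (hu₀ : AnalyticAt ℂ u₀ 0) (hu₀0 : u₀ 0 ≠ 0)
    (hfu : ∀ᶠ t in 𝓝 (0 : ℂ), f (t, 0) = t ^ m * u₀ t) :
    ∃ P : (holomorphicGerms H)[X], P.Monic ∧ P.map (evalZero H) = X ^ m ∧
      ∀ᶠ x in 𝓝 (0 : ℂ × H), f x = 0 → (specialize P x.2).eval x.1 = 0 := by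
  have hne := hu₀.continuousAt.eventually_ne hu₀0
  have hd : ∀ᶠ t in 𝓝 (0 : ℂ), DifferentiableAt ℂ u₀ t :=
    hu₀.eventually_analyticAt.mono fun t ht => ht.differentiableAt
  have hfst : Tendsto (Prod.fst : ℂ × H → ℂ) (𝓝 0) (𝓝 0) := continuous_fst.tendsto 0
  obtain ⟨P, hP, hPm, hPf⟩ := exists_monic_of_eq_pow (f := fun x => f x * (u₀ x.1)⁻¹) (m := m)
    (by
      filter_upwards [hf, hfst.eventually hne, hfst.eventually hd] with x h1 h2 h3
      exact h1.mul ((h3.comp x differentiableAt_fst).inv h2))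
    (by
      filter_upwards [hfu, hne] with t h1 h2
      rw [h1, mul_inv_cancel_right₀ h2])
  refine ⟨P, hP, hPm, ?_⟩
  filter_upwards [hPf] with x hx h0
  exact hx (by simp [h0])

end Weierstrass

section Division

variable {H : Type*} [NormedAddCommGroup H] [NormedSpace ℂ H]

open holomorphicGerms

lemma sum_circleIntegral_mul_inv_eq {ρ : ℝ} (hρ : 0 < ρ) {g : ℂ → ℂ}
    (hg : DiffContOnCl ℂ g (ball 0 ρ)) {p : ℂ[X]} {a : ℕ → ℂ} {n : ℕ}
    (hp : p = ∑ k ∈ Finset.range n, C (a k) * X ^ k)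
    (hne : ∀ t ∈ sphere (0 : ℂ) ρ, p.eval t ≠ 0) {τ : ℂ} (hτ : τ ∈ ball (0 : ℂ) ρ)
    (h0 : p.eval τ = 0) :
    ∑ k ∈ Finset.range n, ∑ j ∈ Finset.range k, a k * ((2 * Real.pi * Complex.I)⁻¹ *
      ∮ s in C(0, ρ), s ^ j * (g s * (p.eval s)⁻¹)) * τ ^ (k - 1 - j) = g τ := by
  have hcont : ContinuousOn (fun s => g s * (p.eval s)⁻¹) (sphere (0 : ℂ) ρ) :=
    (hg.continuousOn_ball.mono sphere_subset_closedBall).mul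
      (p.continuous.continuousOn.inv₀ hne)
  obtain ⟨Λ, hΛ⟩ := exists_linearMap_eq_circleIntegral hρ.le hcont
  set D : ℂ[X] := ∑ k ∈ Finset.range n, ∑ j ∈ Finset.range k,
    (a k * τ ^ (k - 1 - j)) • X ^ j with hD
  have hDp : ∀ s, D.eval s * (s - τ) = p.eval s := by
    intro s
    have h1 : p.eval s = p.eval s - p.eval τ := by rw [h0, sub_zero]
    rw [h1, hp, hD]
    simp only [eval_finsetSum, eval_smul, eval_mul, eval_C, eval_pow, eval_X, smul_eq_mul,
      Finset.sum_mul, ← Finset.sum_sub_distrib]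
    refine Finset.sum_congr rfl fun k _ => ?_
    rw [← mul_sub, ← geom_sum₂_mul, Finset.sum_mul, Finset.mul_sum]
    exact Finset.sum_congr rfl fun j _ => by ring
  have h1 : Λ D = ∑ k ∈ Finset.range n, ∑ j ∈ Finset.range k, a k *
      ((2 * Real.pi * Complex.I)⁻¹ *
        ∮ s in C(0, ρ), s ^ j * (g s * (p.eval s)⁻¹)) * τ ^ (k - 1 - j) := by
    rw [hD, map_sum]
    refine Finset.sum_congr rfl fun k _ => ?_
    rw [map_sum]
    refine Finset.sum_congr rfl fun j _ => ?_
    rw [map_smul, hΛ, smul_eq_mul]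
    simp only [eval_pow, eval_X]
    ring
  have h2 : (∮ s in C(0, ρ), D.eval s * (g s * (p.eval s)⁻¹)) =
      ∮ s in C(0, ρ), (s - τ)⁻¹ • g s := by
    refine circleIntegral.integral_congr hρ.le fun s hs => ?_
    have h3 := hne s hs
    rw [← hDp s] at h3 ⊢
    have h4 := left_ne_zero_of_mul h3
    have h5 := right_ne_zero_of_mul h3
    rw [smul_eq_mul]
    field_simp
  rw [← h1, hΛ, h2, hg.circleIntegral_sub_inv_smul hτ, smul_eq_mul,
    inv_mul_cancel_left₀ Complex.two_pi_I_ne_zero]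

lemma holomorphicGerms.specialize_sum_sum (n : ℕ) (a : ℕ → ℕ → holomorphicGerms H)
    (e : ℕ → ℕ → ℕ) :
    ∀ᶠ z in 𝓝 (0 : H),
      specialize (∑ k ∈ Finset.range n, ∑ j ∈ Finset.range k, C (a k j) * X ^ e k j) z =
        ∑ k ∈ Finset.range n, ∑ j ∈ Finset.range k, C (rep (a k j) z) * X ^ e k j := by
  have h1 : ∀ᶠ z in 𝓝 (0 : H), ∀ k ∈ Finset.range n,
      specialize (∑ j ∈ Finset.range k, C (a k j) * X ^ e k j) z =
        ∑ j ∈ Finset.range k, C (rep (a k j) z) * X ^ e k j := by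
    rw [Filter.eventually_all_finset]
    intro k _
    have h2 : ∀ᶠ z in 𝓝 (0 : H), ∀ j ∈ Finset.range k,
        specialize (C (a k j) * X ^ e k j) z = C (rep (a k j) z) * X ^ e k j := by
      rw [Filter.eventually_all_finset]
      intro j _
      filter_upwards [specialize_mul (C (a k j)) (X ^ e k j), specialize_C (a k j),
        specialize_pow (X : (holomorphicGerms H)[X]) (e k j),
        specialize_X (H := H)] with z h1 h2 h3 h4
      rw [h1, Pi.mul_apply, h2, h3, Pi.pow_apply, h4]
    filter_upwards [specialize_sum (Finset.range k) fun j => C (a k j) * X ^ e k j, h2]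
      with z h3 h4
    rw [h3, Finset.sum_congr rfl h4]
  filter_upwards [specialize_sum (Finset.range n)
    fun k => ∑ j ∈ Finset.range k, C (a k j) * X ^ e k j, h1] with z h3 h4
  rw [h3, Finset.sum_congr rfl h4]

/-- A form of the Weierstrass division theorem. -/
lemma exists_specialize_eval_eq_of_map_eq_X_pow {P : (holomorphicGerms H)[X]} {m : ℕ}
    (hPm : P.map (evalZero H) = X ^ m) {g : ℂ × H → ℂ}
    (hg : ∀ᶠ x in 𝓝 (0 : ℂ × H), DifferentiableAt ℂ g x) :
    ∃ r : (holomorphicGerms H)[X], ∀ᶠ x in 𝓝 (0 : ℂ × H),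
      (specialize P x.2).eval x.1 = 0 → (specialize r x.2).eval x.1 = g x := by
  obtain ⟨R, hR, hball⟩ := eventually_nhds_iff_ball.1 hg
  have hρ : 0 < R / 2 := by positivity
  have hρR : R / 2 < R := by linarith
  generalize R / 2 = ρ at *
  have hmem : ∀ t ∈ closedBall (0 : ℂ) ρ, ∀ z ∈ ball (0 : H) R, (t, z) ∈ ball (0 : ℂ × H) R := by
    intro t ht z hz
    rw [mem_ball_zero_iff] at hz ⊢
    rw [mem_closedBall_zero_iff] at ht
    exact max_lt (ht.trans_lt hρR) hz
  have hsph : ∀ s ∈ sphere (0 : ℂ) ρ, ∀ᶠ x in 𝓝 (s, (0 : H)), DifferentiableAt ℂ g x ∧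
      DifferentiableAt ℂ (fun x : ℂ × H => (specialize P x.2).eval x.1) x ∧
      (specialize P x.2).eval x.1 ≠ 0 := by
    intro s hs
    have h1 : ∀ᶠ x in 𝓝 (s, (0 : H)), x ∈ ball (0 : ℂ × H) R :=
      isOpen_ball.eventually_mem
        (hmem s (sphere_subset_closedBall hs) 0 (mem_ball_self hR))
    have h2 : ∀ᶠ x in 𝓝 (s, (0 : H)),
        DifferentiableAt ℂ (fun x : ℂ × H => (specialize P x.2).eval x.1) x := by
      filter_upwards [(continuous_snd.tendsto (s, (0 : H))).eventually
        (eventually_differentiableAt_specialize_eval P)] with x hx using hx x.1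
    have h3 : (fun x : ℂ × H => (specialize P x.2).eval x.1) (s, 0) ≠ 0 := by
      simp only
      rw [specialize_zero_eq_map, hPm, eval_pow, eval_X]
      refine pow_ne_zero _ ?_
      rintro rfl
      simp at hs
      linarith
    filter_upwards [h1, h2, h2.self_of_nhds.continuousAt.eventually_ne h3] with x h1 h2 h3
    exact ⟨hball x h1, h2, h3⟩
  have hne : ∀ᶠ z in 𝓝 (0 : H), ∀ s ∈ sphere (0 : ℂ) ρ, (specialize P z).eval s ≠ 0 :=
    eventually_forall_of_isCompact (isCompact_sphere 0 ρ)
      (p := fun x : ℂ × H => (specialize P x.2).eval x.1 ≠ 0)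
      fun s hs => (hsph s hs).mono fun x hx => hx.2.2
  have hI : ∀ j : ℕ, ∀ᶠ z in 𝓝 (0 : H), DifferentiableAt ℂ
      (fun z => (2 * Real.pi * Complex.I)⁻¹ *
        ∮ s in C(0, ρ), s ^ j * (g (s, z) * ((specialize P z).eval s)⁻¹)) z := by
    intro j
    have := eventually_differentiableAt_circleIntegral hρ.le
      (k := fun x : ℂ × H => x.1 ^ j * (g x * ((specialize P x.2).eval x.1)⁻¹)) fun t ht => by
        filter_upwards [hsph t ht] with x hx
        exact (differentiableAt_fst.pow j).mul (hx.1.mul (hx.2.1.inv hx.2.2))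
    filter_upwards [this] with z hz using hz.const_mul _
  obtain ⟨b, hb⟩ : ∃ b : ℕ → holomorphicGerms H, ∀ j, rep (b j) =ᶠ[𝓝 0]
      fun z => (2 * Real.pi * Complex.I)⁻¹ *
        ∮ s in C(0, ρ), s ^ j * (g (s, z) * ((specialize P z).eval s)⁻¹) :=
    ⟨fun j => mk _ (hI j), fun j => rep_mk _ (hI j)⟩
  set n := P.natDegree + 1 with hn
  refine ⟨∑ k ∈ Finset.range n, ∑ j ∈ Finset.range k,
    C (P.coeff k * b j) * X ^ (k - 1 - j), ?_⟩
  have hcb : ∀ᶠ z in 𝓝 (0 : H), ∀ k ∈ Finset.range n, ∀ j ∈ Finset.range k,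
      rep (P.coeff k * b j) z = rep (P.coeff k) z * ((2 * Real.pi * Complex.I)⁻¹ *
        ∮ s in C(0, ρ), s ^ j * (g (s, z) * ((specialize P z).eval s)⁻¹)) := by
    rw [Filter.eventually_all_finset]
    intro k _
    rw [Filter.eventually_all_finset]
    intro j _
    filter_upwards [rep_mul (P.coeff k) (b j), hb j] with z h1 h2
    rw [h1, Pi.mul_apply, h2]
  have hz : ∀ᶠ z in 𝓝 (0 : H), ∀ τ ∈ ball (0 : ℂ) ρ, (specialize P z).eval τ = 0 →
      (specialize (∑ k ∈ Finset.range n, ∑ j ∈ Finset.range k,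
        C (P.coeff k * b j) * X ^ (k - 1 - j)) z).eval τ = g (τ, z) := by
    filter_upwards [hne, hcb, specialize_eq_sum P, ball_mem_nhds (0 : H) hR,
      specialize_sum_sum n (fun k j => P.coeff k * b j) fun k j => k - 1 - j]
      with z h1 h2 h3 h4 h5 τ hτ h0
    have hgd : DiffContOnCl ℂ (fun t => g (t, z)) (ball 0 ρ) := by
      refine DifferentiableOn.diffContOnCl ?_
      rw [closure_ball _ hρ.ne']
      exact fun t ht => ((hball _ (hmem t ht z h4)).comp (f := fun t => (t, z)) t
        (by fun_prop)).differentiableWithinAt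
    rw [h5, ← sum_circleIntegral_mul_inv_eq hρ hgd h3 h1 hτ h0, eval_finsetSum]
    refine Finset.sum_congr rfl fun k hk => ?_
    rw [eval_finsetSum]
    refine Finset.sum_congr rfl fun j hj => ?_
    rw [eval_mul, eval_C, h2 k hk j hj, eval_pow, eval_X]
  have h1 : ∀ᶠ x in 𝓝 ((0 : ℂ), (0 : H)), x.1 ∈ ball (0 : ℂ) ρ ∧ ∀ τ ∈ ball (0 : ℂ) ρ,
      (specialize P x.2).eval τ = 0 → (specialize (∑ k ∈ Finset.range n, ∑ j ∈ Finset.range k,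
        C (P.coeff k * b j) * X ^ (k - 1 - j)) x.2).eval τ = g (τ, x.2) := by
    rw [nhds_prod_eq]
    exact (isOpen_ball.eventually_mem (mem_ball_self hρ)).prod_mk hz
  filter_upwards [h1] with x hx h0
  exact hx.2 x.1 hx.1 h0

end Division

section Hurwitz

variable {H : Type*} [NormedAddCommGroup H] [NormedSpace ℂ H]

/-- Hurwitz's theorem: an isolated zero persists under perturbation of the parameter. -/
lemma eventually_exists_norm_lt_eq_zero {g : ℂ × H → ℂ}
    (hg : ∀ᶠ x in 𝓝 (0 : ℂ × H), DifferentiableAt ℂ g x) (hg0 : g 0 = 0)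
    (hne : ∀ᶠ t in 𝓝[≠] (0 : ℂ), g (t, 0) ≠ 0) {ε : ℝ} (hε : 0 < ε) :
    ∀ᶠ z in 𝓝 (0 : H), ∃ t : ℂ, ‖t‖ < ε ∧ g (t, z) = 0 := by
  obtain ⟨r, hr, hball⟩ := Metric.eventually_nhds_iff_ball.1 hg
  obtain ⟨r', hr', hball'⟩ :=
    Metric.eventually_nhds_iff_ball.1 (eventually_nhdsWithin_iff.1 hne)
  obtain ⟨ρ, hρ, hρm⟩ := exists_between (lt_min hε (lt_min hr hr'))
  rw [lt_min_iff, lt_min_iff] at hρm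
  obtain ⟨hρε, hρr, hρr'⟩ := hρm
  have hd : ∀ t : ℂ, ‖t‖ ≤ ρ → ∀ z ∈ ball (0 : H) r, DifferentiableAt ℂ g (t, z) := by
    intro t ht z hz
    refine hball _ ?_
    rw [mem_ball_zero_iff] at hz ⊢
    exact max_lt (ht.trans_lt hρr) hz
  have hcompact : IsCompact (sphere (0 : ℂ) ρ) := isCompact_sphere 0 ρ
  have hsph : ∀ t ∈ sphere (0 : ℂ) ρ, ‖t‖ = ρ := fun t ht => by simpa using ht
  have hc0 : ContinuousOn (fun t : ℂ => ‖g (t, 0)‖) (sphere (0 : ℂ) ρ) := fun t ht =>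
    ((hd t (hsph t ht).le 0 (mem_ball_self hr)).continuousAt.comp
      (f := fun t : ℂ => (t, (0 : H))) (by fun_prop)).norm.continuousWithinAt
  obtain ⟨t₀, ht₀, hmin⟩ := hcompact.exists_isMinOn (NormedSpace.sphere_nonempty.2 hρ.le) hc0
  set δ := ‖g (t₀, 0)‖ with hδ
  have hδ0 : 0 < δ := by
    refine norm_pos_iff.2 (hball' t₀ ?_ ?_)
    · rw [mem_ball_zero_iff, hsph t₀ ht₀]; exact hρr'
    · exact ne_zero_of_mem_sphere hρ.ne' ⟨t₀, ht₀⟩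
  have h1 : ∀ᶠ z in 𝓝 (0 : H), ∀ t ∈ sphere (0 : ℂ) ρ, δ / 2 < ‖g (t, z)‖ :=
    eventually_forall_of_isCompact (p := fun x => δ / 2 < ‖g x‖) hcompact fun t ht =>
      (hd t (hsph t ht).le 0 (mem_ball_self hr)).continuousAt.norm.eventually_const_lt
        ((half_lt_self hδ0).trans_le (hmin ht))
  have h2 : ∀ᶠ z in 𝓝 (0 : H), ‖g (0, z)‖ < δ / 2 := by
    have : ContinuousAt (fun z : H => ‖g (0, z)‖) 0 :=
      (hg.self_of_nhds.continuousAt.comp (f := fun z : H => ((0 : ℂ), z)) (by fun_prop)).norm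
    refine this.eventually_lt_const ?_
    change ‖g 0‖ < _
    rw [hg0, norm_zero]
    positivity
  filter_upwards [h1, h2, ball_mem_nhds (0 : H) hr] with z h1 h2 hz
  by_contra! hcon
  have hcl : closure (ball (0 : ℂ) ρ) = closedBall 0 ρ := closure_ball _ hρ.ne'
  have hdc : DiffContOnCl ℂ (fun t : ℂ => (g (t, z))⁻¹) (ball 0 ρ) := by
    refine DifferentiableOn.diffContOnCl fun t ht => ?_
    rw [hcl, mem_closedBall_zero_iff] at ht
    exact (((hd t ht z hz).comp t (f := fun t : ℂ => (t, z)) (by fun_prop)).inv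
      (hcon t (ht.trans_lt hρε))).differentiableWithinAt
  have := Complex.norm_le_of_forall_mem_frontier_norm_le (C := (δ / 2)⁻¹) isBounded_ball hdc
    (fun t ht => by
      rw [frontier_ball _ hρ.ne'] at ht
      rw [norm_inv]
      exact inv_anti₀ (by positivity) (h1 t ht).le) (z := 0) (subset_closure (mem_ball_self hρ))
  rw [norm_inv, inv_le_inv₀ (norm_pos_iff.2 (hcon 0 (by simpa using hε))) (by positivity)] at this
  linarith

end Hurwitz

lemma map_eq_X_pow_natDegree_of_dvd {R k : Type*} [CommRing R] [Field k] {f : R →+* k}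
    {P p : R[X]} {m : ℕ}
    (hP : P.map f = X ^ m) (hp : p.Monic) (hpP : p ∣ P) : p.map f = X ^ p.natDegree := by
  obtain ⟨i, -, hi⟩ := (dvd_prime_pow prime_X m).1 (hP ▸ Polynomial.map_dvd f hpP)
  have h := eq_of_monic_of_associated (hp.map f) (monic_X_pow i) hi
  rw [← hp.natDegree_map f, h, natDegree_X_pow]

section MonicFactors

variable {R : Type*} [CommRing R] [IsDomain R]

lemma finite_setOf_monic_dvd {P : R[X]} (hP : P.Monic) : {p : R[X] | p.Monic ∧ p ∣ P}.Finite := by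
  set K := FractionRing R
  have hinj : Function.Injective (algebraMap R K) := IsFractionRing.injective R K
  have hfin : {g : K[X] | g.Monic ∧ g ∣ P.map (algebraMap R K)}.Finite :=
    @Finite.of_fintype _ (fintypeSubtypeMonicDvd _ (hP.map _).ne_zero)
  refine Set.Finite.of_finite_image (f := Polynomial.map (algebraMap R K)) ?_
    (Polynomial.map_injective _ hinj).injOn
  refine hfin.subset ?_
  rintro _ ⟨p, ⟨hp, hpP⟩, rfl⟩
  exact ⟨hp.map _, Polynomial.map_dvd _ hpP⟩

/-- Over an integrally closed domain, a monic polynomial `P` and a polynomial `r` either have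
a common monic factor of positive degree, or the ideal they span contains a nonzero constant. -/
lemma exists_monic_common_factor_or_exists_eq_C [IsIntegrallyClosed R] {P : R[X]} (hP : P.Monic)
    (r : R[X]) :
    (∃ p : R[X], p.Monic ∧ 1 ≤ p.natDegree ∧ p ∣ P ∧ p ∣ r) ∨
      ∃ (a b : R[X]) (d : R), d ≠ 0 ∧ a * P + b * r = C d := by
  classical
  set K := FractionRing R
  have hinj : Function.Injective (algebraMap R K) := IsFractionRing.injective R K
  set D := EuclideanDomain.gcd (P.map (algebraMap R K)) (r.map (algebraMap R K)) with hD
  have hDP : D ∣ P.map (algebraMap R K) := EuclideanDomain.gcd_dvd_left _ _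
  have hDr : D ∣ r.map (algebraMap R K) := EuclideanDomain.gcd_dvd_right _ _
  by_cases hu : IsUnit D
  · right
    obtain ⟨a, b, hab⟩ := EuclideanDomain.gcd_isUnit_iff.1 hu
    obtain ⟨s, hs, hsa⟩ := IsLocalization.integerNormalization_spec (nonZeroDivisors R) a
    obtain ⟨t, ht, htb⟩ := IsLocalization.integerNormalization_spec (nonZeroDivisors R) b
    refine ⟨C t * IsLocalization.integerNormalization (nonZeroDivisors R) a,
      C s * IsLocalization.integerNormalization (nonZeroDivisors R) b, s * t,
      mul_ne_zero (nonZeroDivisors.ne_zero hs) (nonZeroDivisors.ne_zero ht), ?_⟩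
    refine Polynomial.map_injective _ hinj ?_
    simp only [Polynomial.map_add, Polynomial.map_mul, map_C, hsa, htb, map_mul]
    rw [← algebraMap_smul K s a, ← algebraMap_smul K t b, smul_eq_C_mul, smul_eq_C_mul]
    linear_combination (C (algebraMap R K s) * C (algebraMap R K t)) * hab
  · left
    obtain ⟨p, hp⟩ := IsIntegrallyClosed.eq_map_mul_C_of_dvd K hP hDP
    have hD0 : D ≠ 0 := fun h0 => (hP.map (algebraMap R K)).ne_zero (by
      rw [h0] at hDP; exact zero_dvd_iff.1 hDP)
    have hlc : D.leadingCoeff ≠ 0 := leadingCoeff_ne_zero.2 hD0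
    have hpm : p.Monic := by
      refine monic_of_injective hinj ?_
      have h1 := congrArg leadingCoeff hp
      rw [leadingCoeff_mul, leadingCoeff_C] at h1
      exact mul_right_cancel₀ hlc (by rw [h1, one_mul])
    have hpD : p.map (algebraMap R K) ∣ D := ⟨_, hp.symm⟩
    refine ⟨p, hpm, ?_, (Polynomial.map_dvd_map _ hinj hpm).1 (hpD.trans hDP),
      (Polynomial.map_dvd_map _ hinj hpm).1 (hpD.trans hDr)⟩
    by_contra hdeg
    have h1 : p = 1 := hpm.natDegree_eq_zero.1 (by omega)
    rw [h1, Polynomial.map_one, one_mul] at hp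
    exact hu (hp ▸ isUnit_C.2 (isUnit_iff_ne_zero.2 hlc))

end MonicFactors

section Functional

lemma dense_setOf_inner_ne_zero {F : Type*} [NormedAddCommGroup F] [InnerProductSpace ℂ F]
    {w : F} (hw : w ≠ 0) : Dense {v : F | inner ℂ v w ≠ 0} := by
  have h : interior ((ℂ ∙ w)ᗮ : Set F) = ∅ := by
    by_contra hne
    have htop := Submodule.eq_top_of_nonempty_interior' _ (nonempty_iff_ne_empty.2 hne)
    have hmem : w ∈ (ℂ ∙ w)ᗮ := htop ▸ Submodule.mem_top
    exact hw (inner_self_eq_zero.1 (Submodule.mem_orthogonal_singleton_iff_inner_right.1 hmem))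
  rw [interior_eq_empty_iff_dense_compl] at h
  convert h using 1
  ext v
  simp [Submodule.mem_orthogonal_singleton_iff_inner_left]

/-- A generic linear functional does not vanish on countably many sequences of nonzero vectors. -/
lemma exists_forall_frequently_inner_ne_zero {E F ι : Type*} [Countable ι]
    [NormedAddCommGroup F] [InnerProductSpace ℂ F] [CompleteSpace F] {l : Filter E}
    [l.IsCountablyGenerated] {S : ι → Set E} {h : E → F}
    (hS : ∀ i, ∃ᶠ x in l, x ∈ S i ∧ h x ≠ 0) :
    ∃ v : F, ∀ i, ∃ᶠ x in l, x ∈ S i ∧ inner ℂ v (h x) ≠ 0 := by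
  choose x hx hxS using fun i => exists_seq_forall_of_frequently (hS i)
  obtain ⟨v, hv⟩ := (dense_iInter_of_isOpen (ι := ι × ℕ)
    (f := fun j => {v : F | inner ℂ v (h (x j.1 j.2)) ≠ 0})
    (fun j => isOpen_ne_fun (by fun_prop) continuous_const)
    fun j => dense_setOf_inner_ne_zero (hxS j.1 j.2).2).nonempty
  refine ⟨v, fun i => (hx i).frequently (Frequently.of_forall fun n => ⟨(hxS i n).1, ?_⟩)⟩
  exact mem_iInter.1 hv (i, n)

end Functional

section TwoEquations

variable {H : Type*} [NormedAddCommGroup H] [NormedSpace ℂ H]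

open holomorphicGerms

lemma holomorphicGerms.frequently_specialize_eval_eq_zero {F : Type*} [Zero F] {h : ℂ × H → F}
    (hnp : ∀ f : ℂ × H → ℂ, (∀ᶠ x in 𝓝 0, DifferentiableAt ℂ f x) → f 0 = 0 →
      (∃ᶠ x in 𝓝 0, f x ≠ 0) → ∃ᶠ x in 𝓝 0, f x = 0 ∧ h x ≠ 0)
    {P p : (holomorphicGerms H)[X]} {m : ℕ} (hP : P.map (evalZero H) = X ^ m) (hp : p.Monic)
    (hdeg : 1 ≤ p.natDegree) (hpP : p ∣ P) :
    ∃ᶠ x in 𝓝 (0 : ℂ × H), (specialize p x.2).eval x.1 = 0 ∧ h x ≠ 0 := by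
  have hval : ∀ t : ℂ, (specialize p (0 : H)).eval t = t ^ p.natDegree := fun t => by
    rw [specialize_zero_eq_map, map_eq_X_pow_natDegree_of_dvd hP hp hpP, eval_pow, eval_X]
  have hsnd : Tendsto (Prod.snd : ℂ × H → H) (𝓝 0) (𝓝 0) := continuous_snd.tendsto 0
  refine hnp _ ((hsnd.eventually (eventually_differentiableAt_specialize_eval p)).mono
    fun x hx => hx x.1) ?_ ?_
  · change (specialize p (0 : H)).eval 0 = 0
    rw [hval, zero_pow (by omega)]
  · have hfst : Tendsto (fun t : ℂ => (t, (0 : H))) (𝓝[≠] 0) (𝓝 0) :=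
      ((by fun_prop : Continuous fun t : ℂ => (t, (0 : H))).tendsto 0).mono_left nhdsWithin_le_nhds
    refine hfst.frequently (Eventually.frequently ?_)
    filter_upwards [self_mem_nhdsWithin] with t ht
    rw [hval]
    exact pow_ne_zero _ ht

lemma exists_functional_of_no_principal_germ {F : Type*} [NormedAddCommGroup F]
    [InnerProductSpace ℂ F] [CompleteSpace F] {h : ℂ × H → F}
    (hh : ∀ᶠ x in 𝓝 (0 : ℂ × H), DifferentiableAt ℂ h x) {φ : F →L[ℂ] ℂ}
    (hφ : ¬ ∀ᶠ t in 𝓝 (0 : ℂ), φ (h (t, 0)) = 0)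
    (hnp : ∀ f : ℂ × H → ℂ, (∀ᶠ x in 𝓝 0, DifferentiableAt ℂ f x) → f 0 = 0 →
      (∃ᶠ x in 𝓝 0, f x ≠ 0) → ∃ᶠ x in 𝓝 0, f x = 0 ∧ h x ≠ 0) :
    ∃ ψ : F →L[ℂ] ℂ, ∀ f : ℂ × H → ℂ, (∀ᶠ x in 𝓝 0, DifferentiableAt ℂ f x) → f 0 = 0 →
      ∃ᶠ x in 𝓝 0, f x = 0 ∧ ¬ (φ (h x) = 0 ∧ ψ (h x) = 0) := by
  have hφd : ∀ᶠ x in 𝓝 (0 : ℂ × H), DifferentiableAt ℂ (fun x => φ (h x)) x :=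
    hh.mono fun x hx => φ.differentiableAt.comp x hx
  have hι : Continuous fun t : ℂ => (t, (0 : H)) := by fun_prop
  have hι0 : Tendsto (fun t : ℂ => (t, (0 : H))) (𝓝 0) (𝓝 0) := hι.tendsto 0
  have han : AnalyticAt ℂ (fun t : ℂ => φ (h (t, 0))) 0 := by
    rw [Complex.analyticAt_iff_eventually_differentiableAt]
    exact (hι0.eventually hφd).mono fun t ht =>
      ht.comp t (f := fun t : ℂ => (t, (0 : H))) (by fun_prop)
  obtain ⟨m, u₀, hu₀, hu₀0, hfu⟩ := han.exists_eventuallyEq_pow_smul_nonzero_iff.2 hφ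
  simp only [sub_zero, smul_eq_mul] at hfu
  obtain ⟨P, hPm, hP, hPz⟩ := exists_monic_of_eq_pow_mul hφd hu₀ hu₀0 hfu
  set 𝒟 := {p : (holomorphicGerms H)[X] | (p.Monic ∧ p ∣ P) ∧ 1 ≤ p.natDegree}
  have : Countable 𝒟 := ((finite_setOf_monic_dvd hPm).subset fun p hp => hp.1).countable
  obtain ⟨v, hv⟩ := exists_forall_frequently_inner_ne_zero (ι := 𝒟) (l := 𝓝 (0 : ℂ × H)) (h := h)
    (S := fun p => {x | (specialize p.1 x.2).eval x.1 = 0})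
    fun p => frequently_specialize_eval_eq_zero hnp hP p.2.1.1 p.2.2 p.2.1.2
  refine ⟨innerSL ℂ v, fun f hf hf0 => ?_⟩
  by_contra hcon
  rw [not_frequently] at hcon
  have hcon : ∀ᶠ x in 𝓝 (0 : ℂ × H), f x = 0 → φ (h x) = 0 ∧ inner ℂ v (h x) = 0 :=
    hcon.mono fun x hx hfx => not_not.1 (not_and.1 hx hfx)
  obtain ⟨r, hr⟩ := exists_specialize_eval_eq_of_map_eq_X_pow hP hf
  have hsnd : Tendsto (Prod.snd : ℂ × H → H) (𝓝 0) (𝓝 0) := continuous_snd.tendsto 0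
  rcases exists_monic_common_factor_or_exists_eq_C hPm r with
    ⟨p, hp, hdeg, ⟨q, hq⟩, ⟨q', hq'⟩⟩ | ⟨a, b, d, hd, hab⟩
  · refine hv ⟨p, ⟨hp, ⟨q, hq⟩⟩, hdeg⟩ ?_
    filter_upwards [hcon, hr, hsnd.eventually (hq ▸ specialize_mul p q),
      hsnd.eventually (hq' ▸ specialize_mul p q')] with x h1 h2 h3 h4
    rintro ⟨h5, h6⟩
    refine h6 (h1 ?_).2
    have h5 : (specialize p x.2).eval x.1 = 0 := h5
    rw [← h2 (by rw [h3, Pi.mul_apply, eval_mul, h5, zero_mul]), h4, Pi.mul_apply, eval_mul, h5,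
      zero_mul]
  · refine hd (eq_zero_of_rep ?_)
    have hne : ∀ᶠ t in 𝓝[≠] (0 : ℂ), f (t, 0) ≠ 0 := by
      rw [eventually_nhdsWithin_iff]
      filter_upwards [hι0.eventually hcon, hfu, hu₀.continuousAt.eventually_ne hu₀0]
        with t h1 h2 h3 ht hft
      rw [(h1 hft).1] at h2
      exact mul_ne_zero (pow_ne_zero m ht) h3 h2.symm
    obtain ⟨ε, hε, hball⟩ := Metric.eventually_nhds_iff_ball.1 (hcon.and (hPz.and hr))
    filter_upwards [eventually_exists_norm_lt_eq_zero hf hf0 hne hε, ball_mem_nhds (0 : H) hε,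
      hab ▸ specialize_add (a * P) (b * r), specialize_mul a P, specialize_mul b r,
      specialize_C d] with z ⟨t, ht, htz⟩ hz h1 h2 h3 h4
    obtain ⟨h5, h6, h7⟩ := hball (t, z) (by
      rw [mem_ball_zero_iff] at hz ⊢
      exact max_lt ht hz)
    have h6 := h6 (h5 htz).1
    have h7 := h7 h6
    rw [htz] at h7
    have h8 := congrArg (eval t) (h4.symm.trans h1)
    simp only [Pi.add_apply, h2, h3, Pi.mul_apply, eval_add, eval_mul, eval_C, h6, h7, mul_zero,
      add_zero] at h8
    exact h8

end TwoEquations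

section PrincipalGerms

variable {E : Type*} [NormedAddCommGroup E] [NormedSpace ℂ E] {A : Set E} {a : E}

lemma containsPrincipalGermAt_of_eventually {f : E → ℂ}
    (hf : ∀ᶠ z in 𝓝 a, DifferentiableAt ℂ f z) (hfa : f a = 0) (hne : ∃ᶠ z in 𝓝 a, f z ≠ 0)
    (hA : ∀ᶠ z in 𝓝 a, f z = 0 → z ∈ A) : ContainsPrincipalGermAt A a := by
  obtain ⟨r, hr, hball⟩ := Metric.eventually_nhds_iff_ball.1 (hf.and hA)
  obtain ⟨z, hz, hzr⟩ := (hne.and_eventually (ball_mem_nhds a hr)).exists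
  exact ⟨ball a r, isOpen_ball, mem_ball_self hr, f,
    fun z hz => (hball z hz).1.differentiableWithinAt, hfa, ⟨z, hzr, hz⟩,
    ball a r, isOpen_ball, mem_ball_self hr, subset_rfl, fun z hz => (hball z hz.1).2 hz.2⟩

lemma ContainsPrincipalGermAt.exists_eventually (h : ContainsPrincipalGermAt A a) :
    ∃ f : E → ℂ, (∀ᶠ z in 𝓝 a, DifferentiableAt ℂ f z) ∧ f a = 0 ∧
      ∀ᶠ z in 𝓝 a, f z = 0 → z ∈ A := by
  obtain ⟨V, hV, haV, f, hf, hfa, -, W, hW, haW, -, hWA⟩ := h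
  refine ⟨f, ?_, hfa, ?_⟩
  · filter_upwards [hV.mem_nhds haV] with z hz using hf.differentiableAt (hV.mem_nhds hz)
  · filter_upwards [hW.mem_nhds haW] with z hz hfz using hWA ⟨hz, hfz⟩

end PrincipalGerms

/- STATEMENT 7: if the germ at 0 of a Hilbert analytic set A = V(h) does not
contain a principal germ, then A is contained in the common zero germ of two
holomorphic functions f₁, f₂, and V(f₁,f₂) still contains no principal germ
at 0.  (Here L and F are separable complex Hilbert spaces.) -/

theorem two_equations_of_no_principal_germ
    {L F : Type*} [NormedAddCommGroup L] [InnerProductSpace ℂ L] [CompleteSpace L]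
    [TopologicalSpace.SeparableSpace L]
    [NormedAddCommGroup F] [InnerProductSpace ℂ F] [CompleteSpace F]
    [TopologicalSpace.SeparableSpace F]
    (U : Set L) (hU : IsOpen U) (h0 : (0 : L) ∈ U)
    (h : L → F) (hh : DifferentiableOn ℂ h U)
    (A : Set L) (hA : A = {z ∈ U | h z = 0})
    (hnp : ¬ ContainsPrincipalGermAt A 0) :
    ∃ (V : Set L) (f₁ f₂ : L → ℂ), IsOpen V ∧ (0 : L) ∈ V ∧ V ⊆ U ∧
      DifferentiableOn ℂ f₁ V ∧ DifferentiableOn ℂ f₂ V ∧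
      A ∩ V ⊆ {z ∈ V | f₁ z = 0 ∧ f₂ z = 0} ∧
      ¬ ContainsPrincipalGermAt {z ∈ V | f₁ z = 0 ∧ f₂ z = 0} 0 := by
  have hUn : ∀ᶠ z in 𝓝 (0 : L), z ∈ U := hU.mem_nhds h0
  by_cases hh0 : h 0 = 0
  swap
  · refine ⟨{z ∈ U | h z ≠ 0}, 1, 1, hh.continuousOn.isOpen_inter_preimage hU isOpen_ne,
      ⟨h0, hh0⟩, fun z hz => hz.1, differentiableOn_const 1, differentiableOn_const 1, ?_, ?_⟩
    · rintro z ⟨hzA, hz⟩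
      rw [hA] at hzA
      exact absurd hzA.2 hz.2
    · intro hcon
      obtain ⟨f, -, hf0, hf⟩ := hcon.exists_eventually
      exact one_ne_zero (hf.self_of_nhds hf0).2.1
  obtain ⟨r, hr, hball⟩ := Metric.isOpen_iff.1 hU 0 h0
  by_cases hz : ∃ e ∈ ball (0 : L) r, h e ≠ 0
  swap
  · push Not at hz
    have : Subsingleton L := by
      by_contra hL
      rw [not_subsingleton_iff_nontrivial] at hL
      obtain ⟨e, he⟩ := exists_ne (0 : L)
      obtain ⟨l, hl⟩ := SeparatingDual.exists_eq_one (R := ℂ) he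
      have ht : Tendsto (fun t : ℂ => t • e) (𝓝[≠] 0) (𝓝 0) := by
        refine Tendsto.mono_left ?_ nhdsWithin_le_nhds
        simpa using (by fun_prop : Continuous fun t : ℂ => t • e).tendsto 0
      refine hnp (containsPrincipalGermAt_of_eventually
        (Eventually.of_forall fun z => l.differentiableAt) (map_zero l)
        (ht.frequently (Eventually.frequently ?_)) ?_)
      · filter_upwards [self_mem_nhdsWithin] with t ht
        rwa [map_smul, hl, smul_eq_mul, mul_one]
      · filter_upwards [ball_mem_nhds (0 : L) hr] with z hzr _
        exact hA ▸ ⟨hball hzr, hz z hzr⟩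
    refine ⟨U, 0, 0, hU, h0, subset_rfl, differentiableOn_const 0, differentiableOn_const 0,
      fun z hz => ⟨hz.2, rfl, rfl⟩, ?_⟩
    rintro ⟨-, -, -, f, -, hf0, ⟨z, -, hz⟩, -⟩
    exact hz (Subsingleton.elim z 0 ▸ hf0)
  obtain ⟨e, he, hhe⟩ := hz
  obtain ⟨l, hl⟩ := SeparatingDual.exists_eq_one (R := ℂ) (x := e) fun he0 => hhe (he0 ▸ hh0)
  set Λ := ContinuousLinearEquiv.equivOfRightInverse l (ContinuousLinearMap.toSpanSingleton ℂ e)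
    (fun t => by simp [hl])
  have hΛ0 : Tendsto Λ (𝓝 0) (𝓝 0) := by simpa using Λ.continuous.tendsto 0
  have hΛs0 : Tendsto Λ.symm (𝓝 0) (𝓝 0) := by simpa using Λ.symm.continuous.tendsto 0
  have hhd : ∀ᶠ z in 𝓝 (0 : L), DifferentiableAt ℂ h z := by
    filter_upwards [hU.eventually_mem h0] with z hz using hh.differentiableAt (hU.mem_nhds hz)
  obtain ⟨ψ, hψ⟩ := exists_functional_of_no_principal_germ (h := fun x => h (Λ.symm x))
    (φ := innerSL ℂ (h e))
    ((hΛs0.eventually hhd).mono fun x hx => hx.comp x Λ.symm.differentiableAt)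
    (by
      have hd : DifferentiableOn ℂ (fun z => innerSL ℂ (h e) (h z)) (ball 0 r) :=
        (innerSL ℂ (h e)).differentiable.comp_differentiableOn (hh.mono hball)
      have := not_eventually_eq_zero_smul hd he (by simpa using hhe)
      simpa [Λ, ContinuousLinearEquiv.equivOfRightInverse_symm_apply] using this)
    (by
      intro f hf hf0 hne
      by_contra hcon
      rw [not_frequently] at hcon
      refine hnp (containsPrincipalGermAt_of_eventually (f := fun z => f (Λ z))
        ((hΛ0.eventually hf).mono fun z hz => hz.comp z Λ.differentiableAt) (by simpa using hf0)
        (hΛs0.frequently (by simpa using hne)) ?_)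
      filter_upwards [hΛ0.eventually hcon, hUn] with z hz hzU hfz
      rw [hA]
      exact ⟨hzU, by simpa [hfz] using hz⟩)
  refine ⟨U, fun z => innerSL ℂ (h e) (h z), fun z => ψ (h z), hU, h0, subset_rfl,
    (innerSL ℂ (h e)).differentiable.comp_differentiableOn hh,
    ψ.differentiable.comp_differentiableOn hh, ?_, ?_⟩
  · rintro z ⟨hzA, hzU⟩
    rw [hA] at hzA
    exact ⟨hzU, by simp [hzA.2], by simp [hzA.2]⟩
  · intro hcon
    obtain ⟨f, hfd, hf0, hf⟩ := hcon.exists_eventually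
    refine hψ (fun x => f (Λ.symm x))
      ((hΛs0.eventually hfd).mono fun x hx => hx.comp x Λ.symm.differentiableAt)
      (by simpa using hf0) ?_
    filter_upwards [hΛs0.eventually hf] with x hx hx'
    exact hx'.2 (hx hx'.1).2
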